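/- Let n ≥ 2, let p,q ∈ ℝⁿ, let v,w ∈ ℝⁿ be unit vectors, let Λ > 0, and let γ : [0,L] → ℝⁿ be a unit-speed curve of minimal length in the class C(p,q;v,w;Λ). If R_O(γ([0,L])) ≥ 1/Λ and κγ(s₀) < Λ for some s₀ ∈ [0,L], then γ itself is a CLC(Λ) curve on [0,L]. -/

import Mathlib

open Set Filter MeasureTheory
open scoped RealInnerProductSpace Topology ENNReal

noncomputable section

/-- Euclidean space `ℝⁿ`. -/
abbrev Euc (n : ℕ) := EuclideanSpace ℝ (Fin n)

/-- Generalized curvature `κγ(s)` of a curve with derivative `γd` and parameter domain `D`: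
the limsup, as `x, y → s` with `x ≠ y`, of `∠(γd x, γd y) / |x - y|`, expressed as the
infimum of all eventual bounds. -/
def curvAt {n : ℕ} (γd : ℝ → Euc n) (D : Set ℝ) (s : ℝ) : ℝ :=
  sInf {Λ : ℝ | 0 ≤ Λ ∧ ∃ δ > 0, ∀ x ∈ D, ∀ y ∈ D, x ≠ y →
    |x - s| < δ → |y - s| < δ →
    InnerProductGeometry.angle (γd x) (γd y) ≤ Λ * |x - y|}

/-- `κγ(s) < Λ`: there are `δ > 0` and `Λ' < Λ` bounding the angle dilation near `s`. -/
def CurvLt {n : ℕ} (γd : ℝ → Euc n) (D : Set ℝ) (s Λ : ℝ) : Prop :=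
  ∃ δ > 0, ∃ Λ' < Λ, ∀ x ∈ D, ∀ y ∈ D, x ≠ y → |x - s| < δ → |y - s| < δ →
    InnerProductGeometry.angle (γd x) (γd y) ≤ Λ' * |x - y|

/-- `f` restricted to `[a, c]` is a planar circular arc of radius `1/Λ`
of length in `[0, 2π/Λ)`. -/
def IsArc {n : ℕ} (Λ : ℝ) (f : ℝ → Euc n) (a c : ℝ) : Prop :=
  c - a < 2 * Real.pi / Λ ∧
  ∃ (o u e : Euc n) (s₁ : ℝ), ‖u‖ = 1 ∧ ‖e‖ = 1 ∧ ⟪u, e⟫ = 0 ∧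
    ∀ s ∈ Icc a c,
      f s = o + (Λ⁻¹ * Real.cos (Λ * (s - s₁))) • u + (Λ⁻¹ * Real.sin (Λ * (s - s₁))) • e

/-- `f` restricted to `[a, c]` is a planar circular arc of radius `r`. -/
def IsArcR {n : ℕ} (r : ℝ) (f : ℝ → Euc n) (a c : ℝ) : Prop :=
  ∃ (o u e : Euc n) (s₁ : ℝ), ‖u‖ = 1 ∧ ‖e‖ = 1 ∧ ⟪u, e⟫ = 0 ∧
    ∀ s ∈ Icc a c,
      f s = o + (r * Real.cos ((s - s₁) / r)) • u + (r * Real.sin ((s - s₁) / r)) • e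

/-- `O_p(v, r)`: the union of the open balls of radius `r` tangent to `v^⊥` at `p`. -/
def Odisk {n : ℕ} (p v : Euc n) (r : ℝ) : Set (Euc n) :=
  {x | ∃ w : Euc n, ‖w‖ = 1 ∧ ⟪w, v⟫ = 0 ∧ ‖x - p - r • w‖ < r}

/-- Ball radius `R_O` of the curve `f` (with derivative/tangent field `γd`) on domain `D`. -/
def RO {n : ℕ} (f γd : ℝ → Euc n) (D : Set ℝ) : ℝ :=
  sInf {r : ℝ | 0 < r ∧ ∃ s ∈ D, ∃ t ∈ D, ∃ w : Euc n,
    ‖w‖ = 1 ∧ ⟪w, γd s⟫ = 0 ∧ ‖f t - f s - r • w‖ < r}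

/-- Minimal double critical distance of the curve `f` with tangent field `γd`. -/
def MDC {n : ℕ} (f γd : ℝ → Euc n) : ℝ :=
  sInf {d : ℝ | ∃ x y : ℝ, f x ≠ f y ∧ ⟪f x - f y, γd x⟫ = 0 ∧
    ⟪f x - f y, γd y⟫ = 0 ∧ d = ‖f x - f y‖}

/-- Normal injectivity radius `i(K, ℝⁿ)` of the curve `f` with tangent field `γd`. -/
def injRad {n : ℕ} (f γd : ℝ → Euc n) : ℝ :=
  sSup ({0} ∪ {r : ℝ | 0 < r ∧ ∀ s t : ℝ, ∀ u w : Euc n,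
    ⟪u, γd s⟫ = 0 → ⟪w, γd t⟫ = 0 → ‖u‖ < r → ‖w‖ < r →
    f s + u = f t + w → f s = f t ∧ u = w})

/-- A knot: a simple closed unit-speed `C^{1,1}` curve, as an `L`-periodic map `ℝ → ℝⁿ`,
injective on `[0, L)`, with `‖γ'‖ ≡ 1` and `γ'` Lipschitz. -/
structure Knot (n : ℕ) where
  L : ℝ
  Lpos : 0 < L
  f : ℝ → Euc n
  fd : ℝ → Euc n
  per : ∀ s, f (s + L) = f s
  perd : ∀ s, fd (s + L) = fd s
  deriv : ∀ s, HasDerivAt f (fd s) s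
  unit : ∀ s, ‖fd s‖ = 1
  lipd : ∃ C : NNReal, LipschitzWith C fd
  inj : InjOn f (Ico 0 L)

/-- Ropelength `ℓ_e(γ) = L / R_O(K)`. -/
def Knot.ropelength {n : ℕ} (k : Knot n) : ℝ := k.L / RO k.f k.fd univ

/-- The set `I_c` of parameters realizing the minimal double critical distance. -/
def Knot.Ic {n : ℕ} (k : Knot n) : Set ℝ :=
  {x | ∃ y : ℝ, k.f x ≠ k.f y ∧ ⟪k.f x - k.f y, k.fd x⟫ = 0 ∧
    ⟪k.f x - k.f y, k.fd y⟫ = 0 ∧ ‖k.f x - k.f y‖ = MDC k.f k.fd}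

/-- `sup_s κγ(s)` for a knot. -/
def Knot.supCurv {n : ℕ} (k : Knot n) : ℝ := ⨆ s : ℝ, curvAt k.fd univ s

/-- Analytic focal distance `F_k(γ) = (sup_s κγ(s))⁻¹`. -/
def Knot.Fk {n : ℕ} (k : Knot n) : ℝ := (k.supCurv)⁻¹

/-- Two knots are in the same knot class: after rescaling their domains to `ℝ/ℤ`
(realized by `1`-periodic maps `ℝ → ℝⁿ`), they are joined by a continuous homotopy
through injective loops. -/
def SameKnotClass {n : ℕ} (k₁ k₂ : Knot n) : Prop :=
  ∃ H : ℝ → ℝ → Euc n,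
    ContinuousOn (fun z : ℝ × ℝ => H z.1 z.2) (Icc 0 1 ×ˢ univ) ∧
    (∀ t s, H t (s + 1) = H t s) ∧
    (∀ s, H 0 s = k₁.f (k₁.L * s)) ∧
    (∀ s, H 1 s = k₂.f (k₂.L * s)) ∧
    ∀ t ∈ Icc (0 : ℝ) 1, InjOn (H t) (Ico 0 1)

/-- A knot is relatively extremal: a relative minimum of ropelength within its knot class
with respect to the `C¹` topology (on rescaled parametrizations). -/
def RelativelyExtremal {n : ℕ} (k : Knot n) : Prop :=
  ∃ ε > 0, ∀ η : Knot n, SameKnotClass k η →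
    (∀ s : ℝ, ‖η.f (η.L * s) - k.f (k.L * s)‖ +
      ‖η.L • η.fd (η.L * s) - k.L • k.fd (k.L * s)‖ < ε) →
    k.ropelength ≤ η.ropelength

/-- The class `C(p, q; v, w; Λ)`: unit-speed `C^{1,1}` curves `γ : [0, L] → ℝⁿ`
(`L` not fixed) from `p` to `q` with initial/terminal directions `v, w`
and `Λ`-Lipschitz derivative (curvature at most `Λ`). -/
structure CurveCC (n : ℕ) (p q v w : Euc n) (Λ : ℝ) where
  L : ℝ
  Lnn : 0 ≤ L
  f : ℝ → Euc n
  fd : ℝ → Euc n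
  deriv : ∀ s ∈ Icc (0 : ℝ) L, HasDerivWithinAt f (fd s) (Icc 0 L) s
  unit : ∀ s ∈ Icc (0 : ℝ) L, ‖fd s‖ = 1
  lip : LipschitzOnWith Λ.toNNReal fd (Icc 0 L)
  i0 : f 0 = p
  id0 : fd 0 = v
  iL : f L = q
  idL : fd L = w

/-- A `C¹` closed curve of period `L` with nowhere-vanishing derivative. -/
structure ClosedC1 (n : ℕ) (L : ℝ) where
  f : ℝ → Euc n
  fd : ℝ → Euc n
  per : ∀ s, f (s + L) = f s
  perd : ∀ s, fd (s + L) = fd s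
  deriv : ∀ s, HasDerivAt f (fd s) s
  nz : ∀ s, fd s ≠ 0

/-- A simple closed `C^{1,1}` curve of period `L` with nowhere-vanishing derivative. -/
structure ClosedC11 (n : ℕ) (L : ℝ) extends ClosedC1 n L where
  lipd : ∃ C : NNReal, LipschitzWith C fd
  inj : InjOn f (Ico 0 L)

/-- The unit tangent field of `c` is `C`-Lipschitz with respect to the arclength of `c`. -/
def TangentLip {n : ℕ} {L : ℝ} (c : ClosedC1 n L) (C : ℝ) : Prop :=
  ∀ x y : ℝ, x ≤ y →
    ‖‖c.fd y‖⁻¹ • c.fd y - ‖c.fd x‖⁻¹ • c.fd x‖ ≤ C * ∫ t in x..y, ‖c.fd t‖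

/-- Pointwise geometric focal distance `F_g(γ(s))` of the curve `f` with domain `D`. -/
def FgPt {n : ℕ} (f fd : ℝ → Euc n) (D : Set ℝ) (s : ℝ) : ℝ :=
  sInf {r : ℝ | 0 < r ∧ f s ∈ closure (Odisk (f s) (fd s) r ∩ (f '' D))}

end

theorem intervalIntegrable_of_norm_le {F : Type*} [NormedAddCommGroup F] {f : ℝ → F}
    (hm : AEStronglyMeasurable f volume) {M : ℝ} (hb : ∀ s, ‖f s‖ ≤ M) (a b : ℝ) :
    IntervalIntegrable f volume a b := by
  rw [intervalIntegrable_iff]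
  exact Measure.integrableOn_of_bounded (M := M) (by simp) hm (ae_of_all _ hb)

theorem lipschitzWith_primitive {F : Type*} [NormedAddCommGroup F] [NormedSpace ℝ F]
    {f : ℝ → F} (hm : AEStronglyMeasurable f volume) {M : NNReal} (hb : ∀ s, ‖f s‖ ≤ M) (a : ℝ) :
    LipschitzWith M (fun s => ∫ t in a..s, f t) := by
  refine LipschitzWith.of_dist_le_mul fun x y => ?_
  rw [dist_eq_norm, intervalIntegral.integral_interval_sub_left
    (intervalIntegrable_of_norm_le hm hb _ _) (intervalIntegrable_of_norm_le hm hb _ _)]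
  have := intervalIntegral.norm_integral_le_of_norm_le_const (a := y) (b := x) (f := f)
    (C := M) (fun s _ => hb s)
  rwa [Real.dist_eq]

theorem ae_hasDerivAt_primitive {F : Type*} [NormedAddCommGroup F] [NormedSpace ℝ F]
    [CompleteSpace F] {f : ℝ → F} (hm : AEStronglyMeasurable f volume) {M : ℝ}
    (hb : ∀ s, ‖f s‖ ≤ M) (a : ℝ) :
    ∀ᵐ s, HasDerivAt (fun s => ∫ t in a..s, f t) (f s) s := by
  have hl : LocallyIntegrable f volume := by
    refine (locallyIntegrable_iff).2 fun k hk => ?_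
    exact Measure.integrableOn_of_bounded (M := M) hk.measure_lt_top.ne hm (ae_of_all _ hb)
  filter_upwards [_root_.LocallyIntegrable.ae_hasDerivAt_integral hl] with s hs using hs a

theorem LipschitzWith.integral_deriv_eq_sub {n : ℕ} {f : ℝ → Euc n} {K : NNReal}
    (hf : LipschitzWith K f) (a b : ℝ) : ∫ s in a..b, deriv f s = f b - f a := by
  have hm : AEStronglyMeasurable (deriv f) volume := (measurable_deriv f).aestronglyMeasurable
  have hb : ∀ s, ‖deriv f s‖ ≤ K := fun s => norm_deriv_le_of_lipschitz hf
  have hl := hf.sub (lipschitzWith_primitive hm hb a)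
  have hac := (hl.lipschitzOnWith (s := uIcc a b)).absolutelyContinuousOnInterval
  obtain ⟨c, hc⟩ := hac.const_of_ae_hasDerivAt_zero (by
    filter_upwards [hf.ae_differentiableAt_real, ae_hasDerivAt_primitive hm hb a] with s h1 h2 _
    have h3 := h1.hasDerivAt.sub h2
    rwa [sub_self] at h3)
  have h1 := hc a left_mem_uIcc
  have h2 := hc b right_mem_uIcc
  simp at h1 h2
  rw [h1, ← h2]; abel

theorem norm_sub_le_integral_of_ae_norm_deriv_le {n : ℕ} {U : ℝ → Euc n} {K : NNReal}
    (hU : LipschitzWith K U) {g : ℝ → ℝ} {a b : ℝ} (hab : a ≤ b)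
    (hg : IntervalIntegrable g volume a b)
    (h : ∀ᵐ s, s ∈ Ioo a b → ‖deriv U s‖ ≤ g s) : ‖U b - U a‖ ≤ ∫ s in a..b, g s := by
  rw [← hU.integral_deriv_eq_sub a b]
  refine intervalIntegral.norm_integral_le_of_norm_le hab ?_ hg
  filter_upwards [h, Measure.ae_ne volume b] with s hs hsb hs'
  exact hs ⟨hs'.1, lt_of_le_of_ne hs'.2 hsb⟩

/-- The direction field of a vector field along the line. -/
noncomputable def direction {n : ℕ} (u : ℝ → Euc n) (s : ℝ) : Euc n := ‖u s‖⁻¹ • u s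

theorem norm_direction {n : ℕ} {u : ℝ → Euc n} {s : ℝ} (h : u s ≠ 0) : ‖direction u s‖ = 1 := by
  simp [direction, norm_smul, h]

theorem norm_smul_direction {n : ℕ} {u : ℝ → Euc n} {s : ℝ} (h : u s ≠ 0) :
    ‖u s‖ • direction u s = u s := by
  simp [direction, smul_smul, h]

theorem norm_direction_sub_sq_le {n : ℕ} {u : ℝ → Euc n} {s t : ℝ} (hs : u s ≠ 0) (ht : u t ≠ 0) :
    ‖direction u s - direction u t‖ ^ 2 ≤ ‖u s - u t‖ ^ 2 / (‖u s‖ * ‖u t‖) := by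
  have h1 : 0 < ‖u s‖ := norm_pos_iff.2 hs
  have h2 : 0 < ‖u t‖ := norm_pos_iff.2 ht
  rw [norm_sub_sq_real, norm_sub_sq_real, norm_direction hs, norm_direction ht,
    le_div_iff₀ (by positivity)]
  have h3 : ‖u s‖ * ‖u t‖ * ⟪direction u s, direction u t⟫ = ⟪u s, u t⟫ := by
    simp only [direction, real_inner_smul_left, real_inner_smul_right]
    field_simp
  nlinarith [sq_nonneg (‖u s‖ - ‖u t‖)]

theorem lipschitzWith_direction {n : ℕ} {u : ℝ → Euc n} {K : NNReal} (hu : LipschitzWith K u)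
    (h : ∀ s, 1 / 2 ≤ ‖u s‖) : LipschitzWith (2 * K) (direction u) := by
  refine LipschitzWith.of_dist_le_mul fun x y => ?_
  have h0 : ∀ s, u s ≠ 0 := fun s => norm_pos_iff.1 (by linarith [h s])
  have h1 := norm_direction_sub_sq_le (h0 x) (h0 y)
  have h2 := hu.dist_le_mul x y
  rw [dist_eq_norm] at h2 ⊢
  have h3 : 1 / 4 ≤ ‖u x‖ * ‖u y‖ := by nlinarith [h x, h y]
  rw [le_div_iff₀ (by positivity)] at h1
  push_cast
  refine abs_le_of_sq_le_sq' ?_ (by positivity) |>.2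
  have h4 : ‖u x - u y‖ ^ 2 ≤ (K * dist x y) ^ 2 := by gcongr
  nlinarith [sq_nonneg ‖direction u x - direction u y‖]

theorem norm_deriv_direction_le {n : ℕ} {u : ℝ → Euc n} {s : ℝ} (hd : DifferentiableAt ℝ u s)
    (hs : u s ≠ 0) : ‖deriv (direction u) s‖ ≤ ‖deriv u s‖ / ‖u s‖ := by
  have h1 : 0 < ‖u s‖ := norm_pos_iff.2 hs
  have hN : DifferentiableAt ℝ (fun t => ‖u t‖) s := hd.norm ℝ hs
  have hdir : DifferentiableAt ℝ (direction u) s := (hN.inv h1.ne').smul hd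
  have hev : ∀ᶠ t in 𝓝 s, u t ≠ 0 := hd.continuousAt.eventually_ne hs
  have e1 : deriv u s = ‖u s‖ • deriv (direction u) s
      + deriv (fun t => ‖u t‖) s • direction u s := by
    have h2 : HasDerivAt (fun t => ‖u t‖ • direction u t) _ s :=
      hN.hasDerivAt.smul hdir.hasDerivAt
    refine (h2.congr_of_eventuallyEq ?_).deriv
    filter_upwards [hev] with t ht
    exact (norm_smul_direction ht).symm
  have e2 : ⟪direction u s, deriv (direction u) s⟫ = 0 := by
    have h3 := hdir.hasDerivAt.inner ℝ hdir.hasDerivAt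
    have h4 : HasDerivAt (fun t => ⟪direction u t, direction u t⟫) 0 s := by
      refine (hasDerivAt_const s (1 : ℝ)).congr_of_eventuallyEq ?_
      filter_upwards [hev] with t ht
      simp [norm_direction ht]
    have h5 := h3.unique h4
    rw [real_inner_comm (direction u s) (deriv (direction u) s)] at h5
    linarith
  rw [le_div_iff₀ h1]
  refine abs_le_of_sq_le_sq' ?_ (by positivity) |>.2
  rw [e1, norm_add_sq_real, inner_smul_left, inner_smul_right, real_inner_comm, e2, norm_smul,
    norm_norm]
  simp
  nlinarith [sq_nonneg ‖deriv (fun t => ‖u t‖) s • direction u s‖]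

/-- A density `m` and a direction field `U` on `[0, L]`, from `v` to `w`, which turns at rate at
most `Λ` with respect to the arclength density `m`. -/
structure IsAdmissible {n : ℕ} (Λ L : ℝ) (v w : Euc n) (m : ℝ → ℝ) (U : ℝ → Euc n) : Prop where
  measurable : Measurable m
  nonneg : ∀ s, 0 ≤ m s
  bounded : ∃ M, ∀ s, m s ≤ M
  unit : ∀ s, ‖U s‖ = 1
  lipschitz : ∃ K, LipschitzWith K U
  norm_deriv_le : ∀ᵐ s, s ∈ Ioo 0 L → ‖deriv U s‖ ≤ Λ * m s
  left : U 0 = v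
  right : U L = w

namespace IsAdmissible

variable {n : ℕ} {Λ L : ℝ} {v w : Euc n} {m : ℝ → ℝ} {U : ℝ → Euc n}

theorem intervalIntegrable (h : IsAdmissible Λ L v w m U) (a b : ℝ) :
    IntervalIntegrable m volume a b := by
  obtain ⟨M, hM⟩ := h.bounded
  exact intervalIntegrable_of_norm_le h.measurable.aestronglyMeasurable
    (fun s => by rw [Real.norm_of_nonneg (h.nonneg s)]; exact hM s) a b

theorem continuous (h : IsAdmissible Λ L v w m U) : Continuous U :=
  h.lipschitz.choose_spec.continuous

theorem intervalIntegrable_smul (h : IsAdmissible Λ L v w m U) (a b : ℝ) :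
    IntervalIntegrable (fun s => m s • U s) volume a b := by
  obtain ⟨M, hM⟩ := h.bounded
  refine intervalIntegrable_of_norm_le (M := M)
    (h.measurable.smul h.continuous.measurable).aestronglyMeasurable (fun s => ?_) a b
  change ‖m s • U s‖ ≤ M
  rw [norm_smul, h.unit, mul_one, Real.norm_of_nonneg (h.nonneg s)]; exact hM s

theorem norm_sub_le (h : IsAdmissible Λ L v w m U) {s t : ℝ} (hs : s ∈ Icc 0 L)
    (ht : t ∈ Icc 0 L) : ‖U t - U s‖ ≤ Λ * |(∫ r in 0..t, m r) - ∫ r in 0..s, m r| := by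
  wlog hst : s ≤ t generalizing s t
  · rw [norm_sub_rev, abs_sub_comm]; exact this ht hs (le_of_not_ge hst)
  obtain ⟨K, hK⟩ := h.lipschitz
  rw [intervalIntegral.integral_interval_sub_left (h.intervalIntegrable _ _)
    (h.intervalIntegrable _ _), abs_of_nonneg
    (intervalIntegral.integral_nonneg hst fun r _ => h.nonneg r),
    ← intervalIntegral.integral_const_mul]
  refine norm_sub_le_integral_of_ae_norm_deriv_le hK hst
    ((h.intervalIntegrable _ _).const_mul _) ?_
  filter_upwards [h.norm_deriv_le] with r hr hrst
  exact hr ⟨hs.1.trans_lt hrst.1, hrst.2.trans_le ht.2⟩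

theorem norm_primitive_sub_le (h : IsAdmissible Λ L v w m U) (hΛ : 0 ≤ Λ) {s t : ℝ}
    (hs : s ∈ Icc 0 L) (ht : t ∈ Icc 0 L) :
    ‖(∫ r in 0..t, m r • U r) - (∫ r in 0..s, m r • U r)
      - ((∫ r in 0..t, m r) - ∫ r in 0..s, m r) • U s‖
      ≤ Λ * |(∫ r in 0..t, m r) - ∫ r in 0..s, m r| ^ 2 := by
  have hmono : Monotone fun t => ∫ r in 0..t, m r := fun x y hxy => by
    have := intervalIntegral.integral_nonneg (μ := volume) hxy fun r _ => h.nonneg r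
    have h2 := intervalIntegral.integral_interval_sub_left (h.intervalIntegrable 0 y)
      (h.intervalIntegrable 0 x)
    simp only; linarith
  obtain ⟨M, hM⟩ := h.bounded
  set σ : ℝ → ℝ := fun t => ∫ r in 0..t, m r with hσ
  change ‖(∫ r in 0..t, m r • U r) - (∫ r in 0..s, m r • U r) - (σ t - σ s) • U s‖
    ≤ Λ * |σ t - σ s| ^ 2
  have e1 : σ t - σ s = ∫ r in s..t, m r := intervalIntegral.integral_interval_sub_left
    (h.intervalIntegrable _ _) (h.intervalIntegrable _ _)
  rw [intervalIntegral.integral_interval_sub_left (h.intervalIntegrable_smul _ _)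
    (h.intervalIntegrable_smul _ _), e1, ← intervalIntegral.integral_smul_const,
    ← intervalIntegral.integral_sub (h.intervalIntegrable_smul _ _)
    (intervalIntegrable_of_norm_le (M := M) (h.measurable.smul_const _).aestronglyMeasurable
      (fun r => by
        rw [norm_smul, h.unit, mul_one, Real.norm_of_nonneg (h.nonneg r)]; exact hM r) _ _)]
  have key : ‖∫ r in s..t, (m r • U r - m r • U s)‖ ≤ |∫ r in s..t, m r * (Λ * |σ t - σ s|)| := by
    refine intervalIntegral.norm_integral_le_abs_of_norm_le ?_
      ((h.intervalIntegrable _ _).mul_const _)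
    refine (ae_restrict_iff' measurableSet_uIoc).2 (ae_of_all _ fun r hr => ?_)
    rw [← smul_sub, norm_smul, Real.norm_of_nonneg (h.nonneg r)]
    refine mul_le_mul_of_nonneg_left ?_ (h.nonneg r)
    have hr' : r ∈ uIcc s t := uIoc_subset_uIcc hr
    have hrL : r ∈ Icc 0 L := uIcc_subset_Icc hs ht hr'
    refine (h.norm_sub_le hs hrL).trans (mul_le_mul_of_nonneg_left ?_ hΛ)
    have := hmono.image_uIcc_subset (mem_image_of_mem σ hr')
    exact abs_sub_left_of_mem_uIcc this
  refine key.trans_eq ?_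
  rw [intervalIntegral.integral_mul_const, ← e1, abs_mul, abs_mul, abs_abs, abs_of_nonneg hΛ]
  ring

/-- Reparametrizing an admissible pair by arclength gives a curve of bounded curvature. -/
theorem exists_curve (h : IsAdmissible Λ L v w m U) (hΛ : 0 ≤ Λ) (hL : 0 ≤ L) {p q : Euc n}
    (hq : p + ∫ s in 0..L, m s • U s = q) :
    ∃ η : CurveCC n p q v w Λ, η.L = ∫ s in 0..L, m s := by
  set σ : ℝ → ℝ := fun t => ∫ r in 0..t, m r with hσ
  set c : ℝ → Euc n := fun t => p + ∫ r in 0..t, m r • U r with hc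
  have hU : ∀ s ∈ Icc 0 L, ∀ t ∈ Icc 0 L, ‖U t - U s‖ ≤ Λ * |σ t - σ s| :=
    fun s hs t ht => h.norm_sub_le hs ht
  have hcσ : ∀ s ∈ Icc 0 L, ∀ t ∈ Icc 0 L,
      ‖c t - c s - (σ t - σ s) • U s‖ ≤ Λ * |σ t - σ s| ^ 2 := fun s hs t ht => by
    have := h.norm_primitive_sub_le hΛ hs ht
    simpa [hc, hσ] using this
  have h0L : (0 : ℝ) ∈ Icc 0 L := ⟨le_rfl, hL⟩
  have hLL : L ∈ Icc 0 L := ⟨hL, le_rfl⟩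
  have hσ0 : σ 0 = 0 := by simp [hσ]
  have hc0 : c 0 = p := by simp [hc]
  have hσc : Continuous σ := intervalIntegral.continuous_primitive h.intervalIntegrable 0
  have hσL : 0 ≤ σ L := intervalIntegral.integral_nonneg hL fun r _ => h.nonneg r
  have hsurj : ∀ τ, ∃ s, τ ∈ Icc 0 (σ L) → s ∈ Icc 0 L ∧ σ s = τ := fun τ => by
    by_cases hτ : τ ∈ Icc 0 (σ L)
    · rw [← hσ0] at hτ
      obtain ⟨s, hs, e⟩ := intermediate_value_Icc hL hσc.continuousOn hτ
      exact ⟨s, fun _ => ⟨hs, e⟩⟩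
    · exact ⟨0, fun h => absurd h hτ⟩
  choose g hg using hsurj
  have hUeq : ∀ s ∈ Icc 0 L, ∀ t ∈ Icc 0 L, σ t = σ s → U t = U s := fun s hs t ht e => by
    have := hU s hs t ht
    rw [e] at this
    simpa [sub_eq_zero] using this
  have hceq : ∀ s ∈ Icc 0 L, ∀ t ∈ Icc 0 L, σ t = σ s → c t = c s := fun s hs t ht e => by
    have := hcσ s hs t ht
    rw [e] at this
    simpa [sub_eq_zero] using this
  have g0 := hg 0 ⟨le_rfl, hσL⟩
  have gL := hg (σ L) ⟨hσL, le_rfl⟩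
  refine ⟨{ L := σ L, Lnn := hσL, f := fun τ => c (g τ), fd := fun τ => U (g τ),
            deriv := fun τ hτ => ?_, unit := fun τ _ => h.unit _, lip := ?_,
            i0 := ?_, id0 := ?_, iL := ?_, idL := ?_ }, rfl⟩
  · rw [hasDerivWithinAt_iff_isLittleO]
    have hO : (fun x => c (g x) - c (g τ) - (x - τ) • U (g τ)) =O[𝓝[Icc 0 (σ L)] τ]
        fun x => (x - τ) ^ 2 := by
      refine Asymptotics.IsBigO.of_bound Λ ?_
      filter_upwards [self_mem_nhdsWithin] with x hx
      have := hcσ (g τ) (hg τ hτ).1 (g x) (hg x hx).1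
      rw [(hg τ hτ).2, (hg x hx).2] at this
      rwa [norm_pow, Real.norm_eq_abs]
    refine hO.trans_isLittleO ?_
    refine Asymptotics.IsLittleO.mono ?_ nhdsWithin_le_nhds
    have : Tendsto (fun x : ℝ => x - τ) (𝓝 τ) (𝓝 0) := by
      have := (continuous_sub_right τ).tendsto τ
      rwa [sub_self] at this
    have h2 := (Asymptotics.isLittleO_pow_id (𝕜 := ℝ) (n := 2) (by norm_num)).comp_tendsto this
    exact h2
  · refine LipschitzOnWith.of_dist_le_mul fun x hx y hy => ?_
    have := hU (g y) (hg y hy).1 (g x) (hg x hx).1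
    rw [(hg y hy).2, (hg x hx).2] at this
    rwa [dist_eq_norm, Real.dist_eq, Real.coe_toNNReal _ hΛ]
  · exact (hceq _ h0L _ g0.1 (g0.2.trans hσ0.symm)).trans hc0
  · exact (hUeq _ h0L _ g0.1 (g0.2.trans hσ0.symm)).trans h.left
  · exact (hceq _ hLL _ gL.1 gL.2).trans hq
  · exact (hUeq _ hLL _ gL.1 gL.2).trans h.right

end IsAdmissible

/-- A unit direction field on `[0, L]`, turning at rate at most `Λ`, whose integral curve is no
longer than that of any admissible pair with the same boundary data and total displacement. -/
structure IsMinimalField {n : ℕ} (Λ L : ℝ) (T : ℝ → Euc n) : Prop where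
  pos : 0 < Λ
  length_pos : 0 < L
  unit : ∀ s, ‖T s‖ = 1
  lipschitz : LipschitzWith Λ.toNNReal T
  le_integral : ∀ (m : ℝ → ℝ) (U : ℝ → Euc n), IsAdmissible Λ L (T 0) (T L) m U →
    ∫ s in 0..L, m s • U s = ∫ s in 0..L, T s → L ≤ ∫ s in 0..L, m s

namespace IsMinimalField

variable {n : ℕ} {Λ L : ℝ} {T : ℝ → Euc n}

theorem norm_deriv_le (h : IsMinimalField Λ L T) (s : ℝ) : ‖deriv T s‖ ≤ Λ := by
  have := norm_deriv_le_of_lipschitz (x₀ := s) h.lipschitz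
  rwa [Real.coe_toNNReal _ h.pos.le] at this

theorem continuous (h : IsMinimalField Λ L T) : Continuous T := h.lipschitz.continuous

theorem measurable_deriv (_ : IsMinimalField Λ L T) : Measurable (deriv T) :=
  _root_.measurable_deriv T

end IsMinimalField

/-- A density supported away from an interval on which the curve closes up. -/
theorem IsMinimalField.not_closed {n : ℕ} {Λ L : ℝ} {T : ℝ → Euc n} (h : IsMinimalField Λ L T)
    {a b : ℝ} (ha : 0 ≤ a) (hab : a < b) (hb : b ≤ L) (hT : T a = T b)
    (hI : ∫ s in a..b, T s = 0) : False := by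
  set m : ℝ → ℝ := (Ioc a b)ᶜ.indicator fun _ => 1 with hm
  set U : ℝ → Euc n := fun s => T s - T (max a (min s b)) + T a with hU
  have hUl : ∀ s ≤ a, U s = T s := fun s hs => by
    simp [hU, min_eq_left (hs.trans hab.le), max_eq_left hs]
  have hUm : ∀ s ∈ Icc a b, U s = T a := fun s hs => by
    simp [hU, min_eq_left hs.2, max_eq_right hs.1]
  have hUr : ∀ s, b ≤ s → U s = T s := fun s hs => by
    simp [hU, min_eq_right hs, max_eq_right hab.le, hT]
  have m1 : ∀ s, s ∉ Ioc a b → m s = 1 := fun s hs => by simp [hm, hs]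
  have m0 : ∀ s ∈ Ioc a b, m s = 0 := fun s hs => by simp [hm, hs]
  have m01 : ∀ s, 0 ≤ m s ∧ m s ≤ 1 := fun s => by
    by_cases hs : s ∈ Ioc a b
    · simp [m0 s hs]
    · simp [m1 s hs]
  have hadm : IsAdmissible Λ L (T 0) (T L) m U := by
    refine ⟨measurable_const.indicator measurableSet_Ioc.compl, fun s => (m01 s).1,
      ⟨1, fun s => (m01 s).2⟩, fun s => ?_, ⟨Λ.toNNReal + Λ.toNNReal + 0, ?_⟩, ?_,
      hUl 0 ha, hUr L hb⟩
    · rcases le_total s a with h1 | h1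
      · rw [hUl s h1, h.unit]
      · rcases le_total s b with h2 | h2
        · rw [hUm s ⟨h1, h2⟩, h.unit]
        · rw [hUr s h2, h.unit]
    · refine (h.lipschitz.sub ?_).add (LipschitzWith.const _)
      have : LipschitzWith 1 fun s : ℝ => max a (min s b) :=
        (LipschitzWith.id.min_const b).const_max a
      have h5 := h.lipschitz.comp this
      rwa [mul_one] at h5
    · filter_upwards [Measure.ae_ne volume a, Measure.ae_ne volume b] with s h1 h2 _
      rcases lt_or_gt_of_ne h1 with h1 | h1
      · have : U =ᶠ[𝓝 s] T := by
          filter_upwards [Iio_mem_nhds h1] with r hr using hUl r (le_of_lt hr)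
        rw [this.deriv_eq, m1 s (fun hs => absurd hs.1 (not_lt.2 h1.le)), mul_one]
        exact h.norm_deriv_le s
      · rcases lt_or_gt_of_ne h2 with h2 | h2
        · have : U =ᶠ[𝓝 s] fun _ => T a := by
            filter_upwards [Ioo_mem_nhds h1 h2] with r hr using hUm r ⟨hr.1.le, hr.2.le⟩
          rw [this.deriv_eq, m0 s ⟨h1, h2.le⟩]
          simp
        · have : U =ᶠ[𝓝 s] T := by
            filter_upwards [Ioi_mem_nhds h2] with r hr using hUr r (le_of_lt hr)
          rw [this.deriv_eq, m1 s (fun hs => absurd hs.2 (not_le.2 h2)), mul_one]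
          exact h.norm_deriv_le s
  have split : ∀ {F : Type} [NormedAddCommGroup F] [NormedSpace ℝ F] (f g : ℝ → F),
      (∀ x y, IntervalIntegrable f volume x y) → (∀ x y, IntervalIntegrable g volume x y) →
      (∀ s ∉ Ioc a b, f s = g s) → (∀ s ∈ Ioc a b, f s = 0) →
      ∫ s in 0..L, f s = (∫ s in 0..L, g s) - ∫ s in a..b, g s := by
    intro F _ _ f g hf hg h1 h0
    rw [← intervalIntegral.integral_add_adjacent_intervals (hf 0 a) (hf a L),
      ← intervalIntegral.integral_add_adjacent_intervals (hf a b) (hf b L),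
      ← intervalIntegral.integral_add_adjacent_intervals (hg 0 a) (hg a L),
      ← intervalIntegral.integral_add_adjacent_intervals (hg a b) (hg b L)]
    have e1 : ∫ s in 0..a, f s = ∫ s in 0..a, g s :=
      intervalIntegral.integral_congr_ae (ae_of_all _ fun s hs => by
        rw [uIoc_of_le ha] at hs; exact h1 s fun h => absurd hs.2 (not_le.2 h.1))
    have e2 : ∫ s in b..L, f s = ∫ s in b..L, g s :=
      intervalIntegral.integral_congr_ae (ae_of_all _ fun s hs => by
        rw [uIoc_of_le hb] at hs; exact h1 s fun h => absurd hs.1 (not_lt.2 h.2))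
    have e3 : ∫ s in a..b, f s = ∫ s in a..b, (0 : F) :=
      intervalIntegral.integral_congr_ae (ae_of_all _ fun s hs => by
        rw [uIoc_of_le hab.le] at hs; exact h0 s hs)
    rw [e1, e2, e3, intervalIntegral.integral_zero]
    abel
  have hle := h.le_integral m U hadm (by
    rw [split _ T hadm.intervalIntegrable_smul (fun _ _ => h.continuous.intervalIntegrable _ _),
      hI, sub_zero]
    · intro s hs
      rw [m1 s hs, one_smul]
      rcases le_or_gt s a with h1 | h1
      · exact hUl s h1
      · exact hUr s (not_lt.1 fun h2 => hs ⟨h1, h2.le⟩)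
    · intro s hs
      rw [m0 s hs, zero_smul])
  rw [split m (fun _ => 1) hadm.intervalIntegrable
    (fun _ _ => continuous_const.intervalIntegrable _ _) m1 m0] at hle
  simp at hle
  linarith

theorem exists_bump {α β L : ℝ} (hα : 0 ≤ α) (hαβ : α < β) (hβ : β ≤ L) :
    ∃ ψ : ℝ → ℝ, Differentiable ℝ ψ ∧ (∀ s, 0 ≤ ψ s) ∧ (∀ s ∈ Ioo α β, 0 < ψ s) ∧
      (∀ s ∉ Ioo α β, ψ s = 0 ∧ deriv ψ s = 0) ∧ (∫ s in 0..L, ψ s = 1) ∧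
      ∃ K : NNReal, 0 < K ∧ (∀ s, ψ s ≤ K) ∧ (∀ s, |deriv ψ s| ≤ K) := by
  let f : ContDiffBump ((α + β) / 2) := ⟨(β - α) / 4, (β - α) / 2, by linarith, by linarith⟩
  have hsupp : Function.support (f.normed volume) = Ioo α β := by
    rw [f.support_normed_eq, Real.ball_eq_Ioo]
    congr 1 <;> simp only [f] <;> ring
  have hc : ContDiff ℝ 1 (f.normed volume) := f.contDiff_normed (n := 1)
  have h0 : ∀ s ∉ Ioo α β, f.normed volume s = 0 := fun s hs => by
    rw [← hsupp] at hs; exact Function.notMem_support.1 hs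
  obtain ⟨K1, hK1⟩ := f.hasCompactSupport_normed (μ := volume).exists_bound_of_continuous
    hc.continuous
  obtain ⟨K2, hK2⟩ := (f.hasCompactSupport_normed (μ := volume)).deriv.exists_bound_of_continuous
    (hc.continuous_deriv le_rfl)
  refine ⟨f.normed volume, hc.differentiable one_ne_zero, f.nonneg_normed, fun s hs => ?_,
    fun s hs => ⟨h0 s hs, ?_⟩, ?_, (|K1| + |K2| + 1).toNNReal, ?_, fun s => ?_, fun s => ?_⟩
  · rw [← hsupp] at hs
    exact lt_of_le_of_ne (f.nonneg_normed s) (Ne.symm hs)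
  · refine IsLocalMin.deriv_eq_zero (Eventually.of_forall fun t => ?_)
    rw [h0 s hs]
    exact f.nonneg_normed t
  · rw [intervalIntegral.integral_of_le (by linarith),
      setIntegral_eq_integral_of_forall_compl_eq_zero, f.integral_normed]
    exact fun s hs => h0 s fun h => hs ⟨by linarith [h.1], by linarith [h.2]⟩
  · rw [Real.toNNReal_pos]; positivity
  · rw [Real.coe_toNNReal _ (by positivity)]
    have := hK1 s
    rw [Real.norm_of_nonneg (f.nonneg_normed s)] at this
    linarith [le_abs_self K1, abs_nonneg K2]
  · rw [Real.coe_toNNReal _ (by positivity)]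
    have := hK2 s
    rw [Real.norm_eq_abs] at this
    linarith [le_abs_self K2, abs_nonneg K1]

theorem LipschitzWith.exists_smul {n : ℕ} {ψ : ℝ → ℝ} {g : ℝ → Euc n} {K M B : NNReal}
    (hψ : LipschitzWith K ψ) (hg : LipschitzWith M g) {C : NNReal} (hψC : ∀ s, |ψ s| ≤ C)
    (hgB : ∀ s, ‖g s‖ ≤ B) : LipschitzWith (C * M + K * B) (fun s => ψ s • g s) := by
  refine LipschitzWith.of_dist_le_mul fun x y => ?_
  have e : ψ x • g x - ψ y • g y = ψ x • (g x - g y) + (ψ x - ψ y) • g y := by module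
  have h1 := hψ.dist_le_mul x y
  have h2 := hg.dist_le_mul x y
  rw [dist_eq_norm] at h1 h2 ⊢
  rw [e]
  refine (norm_add_le _ _).trans ?_
  rw [norm_smul, norm_smul, Real.norm_eq_abs (ψ x)]
  push_cast
  have h3 : |ψ x| * ‖g x - g y‖ ≤ C * (M * dist x y) :=
    mul_le_mul (hψC x) h2 (norm_nonneg _) C.2
  have h4 : ‖ψ x - ψ y‖ * ‖g y‖ ≤ K * dist x y * B :=
    mul_le_mul h1 (hgB y) (norm_nonneg _) (by positivity)
  linarith

namespace IsMinimalField

variable {n : ℕ} {Λ L : ℝ} {T : ℝ → Euc n}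

/-- A minimal field is constant wherever the curvature bound is slack. -/
theorem exists_eq_const (h : IsMinimalField Λ L T) {α β κ : ℝ} (hα : 0 ≤ α) (hαβ : α < β)
    (hβ : β ≤ L) (hκ : κ < Λ) (hT : ∀ s ∈ Ioo α β, ‖deriv T s‖ ≤ κ) :
    ∃ A, ∀ s ∈ Ioo α β, T s = A := by
  obtain ⟨ψ, ψd, ψ0, ψpos, ψout, ψint, K, K0, ψK, ψK'⟩ := exists_bump hα hαβ hβ
  have hL := h.length_pos
  have hΛ := h.pos
  have ψabs : ∀ s, |ψ s| ≤ K := fun s => by rw [abs_of_nonneg (ψ0 s)]; exact ψK s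
  have ψlip : LipschitzWith K ψ := lipschitzWith_of_nnnorm_deriv_le ψd fun s => ψK' s
  have hTc := h.continuous
  have hψc := ψd.continuous
  set A : Euc n := ∫ s in 0..L, ψ s • T s with hA
  have hψT : ∀ x y, IntervalIntegrable (fun s => ψ s • T s) volume x y :=
    fun x y => (hψc.smul hTc).intervalIntegrable _ _
  have hψi : ∀ x y, IntervalIntegrable ψ volume x y := fun x y => hψc.intervalIntegrable _ _
  have hsq : ∫ s in 0..L, ψ s * ‖T s - A‖ ^ 2 = 1 - ‖A‖ ^ 2 := by
    have e1 : ∀ s, ψ s * ‖T s - A‖ ^ 2 = (1 + ‖A‖ ^ 2) * ψ s - 2 * ⟪A, ψ s • T s⟫ := fun s => by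
      rw [norm_sub_sq_real, h.unit, real_inner_smul_right, real_inner_comm]; ring
    have e2 : ∫ s in 0..L, ⟪A, ψ s • T s⟫ = ⟪A, A⟫ := by
      have := (innerSL ℝ A).intervalIntegral_comp_comm (hψT 0 L)
      simpa only [innerSL_apply_apply] using this
    have i1 : IntervalIntegrable (fun s => (1 + ‖A‖ ^ 2) * ψ s) volume 0 L :=
      (hψi _ _).const_mul _
    have i2 : IntervalIntegrable (fun s => 2 * ⟪A, ψ s • T s⟫) volume 0 L :=
      Continuous.intervalIntegrable (by fun_prop) _ _
    simp_rw [e1]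
    rw [intervalIntegral.integral_sub i1 i2,
      intervalIntegral.integral_const_mul, intervalIntegral.integral_const_mul, ψint, e2,
      real_inner_self_eq_norm_sq]
    ring
  have hnn : ∀ s, 0 ≤ ψ s * ‖T s - A‖ ^ 2 := fun s => mul_nonneg (ψ0 s) (sq_nonneg _)
  have hA1 : ‖A‖ ≤ 1 := by
    have := intervalIntegral.integral_nonneg (μ := volume) hL.le fun s _ => hnn s
    rw [hsq] at this
    nlinarith [norm_nonneg A]
  refine ⟨A, ?_⟩
  by_contra! hne
  obtain ⟨s₁, hs₁, hs₁A⟩ := hne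
  have hA1' : ‖A‖ < 1 := by
    have hpos : 0 < ∫ s in 0..L, ψ s * ‖T s - A‖ ^ 2 := by
      refine intervalIntegral.integral_pos hL
        (hψc.mul ((hTc.sub continuous_const).norm.pow 2)).continuousOn (fun s _ => hnn s)
        ⟨s₁, ⟨by linarith [hs₁.1], by linarith [hs₁.2]⟩, ?_⟩
      have := norm_pos_iff.2 (sub_ne_zero.2 hs₁A)
      have := ψpos s₁ hs₁
      positivity
    rw [hsq] at hpos
    nlinarith [norm_nonneg A]
  have hK : (0 : ℝ) < K := K0
  have hκ0 : 0 ≤ κ := (norm_nonneg _).trans (hT s₁ hs₁)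
  obtain ⟨ε, ε0, hε1, hε2⟩ : ∃ ε : ℝ, 0 < ε ∧ ε * K ≤ 1 / 4 ∧
      κ + 2 * (ε * K) ≤ Λ * (1 - 4 * (ε * K)) := by
    refine ⟨min (1 / 4) ((Λ - κ) / (2 + 4 * Λ)) / K, ?_, ?_, ?_⟩
    · have : 0 < (Λ - κ) / (2 + 4 * Λ) := div_pos (by linarith) (by positivity)
      positivity
    · rw [div_mul_cancel₀ _ hK.ne']
      exact min_le_left _ _
    · rw [div_mul_cancel₀ _ hK.ne']
      have := min_le_right (1 / 4) ((Λ - κ) / (2 + 4 * Λ))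
      rw [le_div_iff₀ (by positivity)] at this
      linarith
  have hψε : ∀ s, 0 ≤ ε * ψ s ∧ ε * ψ s ≤ ε * K := fun s =>
    ⟨mul_nonneg ε0.le (ψ0 s), mul_le_mul_of_nonneg_left (ψK s) ε0.le⟩
  have hTA : ∀ s, ‖A - T s‖ ≤ 2 := fun s => by
    refine (norm_sub_le _ _).trans ?_
    rw [h.unit]; linarith
  set u : ℝ → Euc n := fun s => T s + ε • ψ s • (A - T s) with hu
  have hu_out : ∀ s ∉ Ioo α β, u s = T s := fun s hs => by simp [hu, (ψout s hs).1]
  have hu_le : ∀ s, ‖u s‖ ≤ 1 - ε * ψ s * (1 - ‖A‖) := fun s => by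
    have e : u s = (1 - ε * ψ s) • T s + (ε * ψ s) • A := by simp only [hu]; module
    rw [e]
    refine (norm_add_le _ _).trans ?_
    rw [norm_smul, norm_smul, h.unit, Real.norm_of_nonneg (hψε s).1,
      Real.norm_of_nonneg (by linarith [hψε s])]
    linarith
  have hu_ge : ∀ s, 1 - 2 * (ε * K) ≤ ‖u s‖ := fun s => by
    have h1 : ‖T s‖ ≤ ‖u s‖ + ‖ε • ψ s • (A - T s)‖ := by
      have := norm_sub_le (u s) (ε • ψ s • (A - T s))
      simpa [hu] using this
    rw [h.unit, smul_smul, norm_smul, Real.norm_of_nonneg (hψε s).1] at h1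
    have h2 : ε * ψ s * ‖A - T s‖ ≤ ε * K * 2 :=
      mul_le_mul (hψε s).2 (hTA s) (norm_nonneg _) (by positivity)
    linarith
  have hu_half : ∀ s, 1 / 2 ≤ ‖u s‖ := fun s => by linarith [hu_ge s]
  have hu0 : ∀ s, u s ≠ 0 := fun s => norm_pos_iff.1 (by linarith [hu_half s])
  have hdir_out : ∀ s ∉ Ioo α β, direction u s = T s := fun s hs => by
    simp [direction, hu_out s hs, h.unit]
  have hulip : ∃ M, LipschitzWith M u := by
    have h1 := ψlip.exists_smul (B := 2) ((LipschitzWith.const A).sub h.lipschitz) ψabs hTA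
    have h2 : LipschitzWith _ (fun s => ε • ψ s • (A - T s)) :=
      (lipschitzWith_smul ε).comp h1
    exact ⟨_, h.lipschitz.add h2⟩
  obtain ⟨M, hM⟩ := hulip
  have hadm : IsAdmissible Λ L (T 0) (T L) (fun s => ‖u s‖) (direction u) := by
    refine ⟨hM.continuous.norm.measurable, fun s => norm_nonneg _, ⟨1, fun s => ?_⟩,
      fun s => norm_direction (hu0 s), ⟨_, lipschitzWith_direction hM hu_half⟩, ?_,
      hdir_out 0 fun hs => absurd hs.1 (not_lt.2 hα),
      hdir_out L fun hs => absurd hs.2 (not_lt.2 hβ)⟩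
    · have : 0 ≤ ε * ψ s * (1 - ‖A‖) := mul_nonneg (hψε s).1 (by linarith)
      linarith [hu_le s]
    · filter_upwards [h.lipschitz.ae_differentiableAt_real] with s hs _
      have hud : HasDerivAt u (deriv T s + ε • (ψ s • (0 - deriv T s) + deriv ψ s • (A - T s))) s :=
        hs.hasDerivAt.add (((ψd s).hasDerivAt.smul
          ((hasDerivAt_const s A).sub hs.hasDerivAt)).const_smul ε)
      refine (norm_deriv_direction_le hud.differentiableAt (hu0 s)).trans ?_
      rw [hud.deriv, div_le_iff₀ (norm_pos_iff.2 (hu0 s))]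
      by_cases hsI : s ∈ Ioo α β
      · have e : deriv T s + ε • (ψ s • (0 - deriv T s) + deriv ψ s • (A - T s))
            = (1 - ε * ψ s) • deriv T s + (ε * deriv ψ s) • (A - T s) := by module
        have h1 : ‖(1 - ε * ψ s) • deriv T s‖ ≤ κ := by
          rw [norm_smul, Real.norm_of_nonneg (by linarith [hψε s])]
          have := hT s hsI
          nlinarith [hψε s, norm_nonneg (deriv T s)]
        have h2 : ‖(ε * deriv ψ s) • (A - T s)‖ ≤ ε * K * 2 := by
          rw [norm_smul, norm_mul, Real.norm_of_nonneg ε0.le, Real.norm_eq_abs]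
          exact mul_le_mul (mul_le_mul_of_nonneg_left (ψK' s) ε0.le) (hTA s) (norm_nonneg _)
            (by positivity)
        have h3 := norm_add_le ((1 - ε * ψ s) • deriv T s) ((ε * deriv ψ s) • (A - T s))
        rw [e]
        have h4 : (1 - 4 * (ε * K)) ≤ ‖u s‖ * ‖u s‖ := by
          nlinarith [hu_ge s, mul_pos ε0 hK]
        have h5 := mul_le_mul_of_nonneg_left h4 hΛ.le
        linarith
      · rw [(ψout s hsI).1, (ψout s hsI).2, hu_out s hsI, h.unit]
        simpa using h.norm_deriv_le s
  have hle := h.le_integral _ _ hadm (by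
    simp_rw [norm_smul_direction (hu0 _)]
    have e : ∀ s, u s = T s + ε • (ψ s • A - ψ s • T s) := fun s => by simp only [hu]; module
    have i1 : IntervalIntegrable (fun s => ψ s • A) volume 0 L :=
      Continuous.intervalIntegrable (by fun_prop) _ _
    have i2 : IntervalIntegrable (fun s => ε • (ψ s • A - ψ s • T s)) volume 0 L :=
      Continuous.intervalIntegrable (by fun_prop) _ _
    simp_rw [e]
    rw [intervalIntegral.integral_add (hTc.intervalIntegrable _ _) i2,
      intervalIntegral.integral_smul, intervalIntegral.integral_sub i1 (hψT _ _),
      intervalIntegral.integral_smul_const, ψint]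
    simp [hA])
  have hmono := intervalIntegral.integral_mono_on hL.le (hadm.intervalIntegrable 0 L)
    (g := fun s => 1 - ε * ψ s * (1 - ‖A‖))
    (Continuous.intervalIntegrable (by fun_prop) _ _) (fun s _ => hu_le s)
  have i1 : IntervalIntegrable (fun s => ε * ψ s * (1 - ‖A‖)) volume 0 L :=
    Continuous.intervalIntegrable (by fun_prop) _ _
  rw [intervalIntegral.integral_sub intervalIntegrable_const i1,
    intervalIntegral.integral_mul_const, intervalIntegral.integral_const_mul, ψint] at hmono
  simp at hmono
  nlinarith [mul_pos ε0 (sub_pos.2 hA1')]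

/-- First-order minimality with free endpoint: along a straight piece of direction `e`, a
displacement error `Δ` can be corrected at cost `-⟪e, Δ⟫` to first order. -/
theorem exists_compensation (h : IsMinimalField Λ L T) {α β : ℝ} {e : Euc n} (hα : 0 ≤ α)
    (hαβ : α < β) (hβ : β ≤ L) (he : ‖e‖ = 1) :
    ∃ C r : ℝ, 0 < r ∧ ∀ m U, IsAdmissible Λ L (T 0) (T L) m U →
      (∀ s ∈ Ioo α β, m s = 1 ∧ U s = e) → ∀ Δ : Euc n,
      Δ = (∫ s in 0..L, m s • U s) - (∫ s in 0..L, T s) → ‖Δ‖ ≤ r →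
      L ≤ (∫ s in 0..L, m s) - ⟪e, Δ⟫ + C * ‖Δ‖ ^ 2 := by
  obtain ⟨ψ, ψd, ψ0, ψpos, ψout, ψint, K, K0, ψK, ψK'⟩ := exists_bump hα hαβ hβ
  have hL := h.length_pos
  have hΛ := h.pos
  have hK : (0 : ℝ) < K := K0
  have ψabs : ∀ s, |ψ s| ≤ K := fun s => by rw [abs_of_nonneg (ψ0 s)]; exact ψK s
  have ψlip : LipschitzWith K ψ := lipschitzWith_of_nnnorm_deriv_le ψd fun s => ψK' s
  have hψc := ψd.continuous
  refine ⟨K / 2, min (1 / 2) (Λ / 4) / K, by positivity, fun m U hadm hmU Δ hΔ hr => ?_⟩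
  rw [le_div_iff₀ hK] at hr
  have hr1 := hr.trans (min_le_left _ _)
  have hr2 := hr.trans (min_le_right _ _)
  set u : ℝ → Euc n := fun s => U s + ψ s • (-Δ) with hu
  have hu_out : ∀ s ∉ Ioo α β, u s = U s := fun s hs => by simp [hu, (ψout s hs).1]
  have hsmall : ∀ s, ‖ψ s • (-Δ)‖ ≤ ‖Δ‖ * K := fun s => by
    rw [norm_smul, norm_neg, Real.norm_of_nonneg (ψ0 s), mul_comm]
    exact mul_le_mul_of_nonneg_left (ψK s) (norm_nonneg _)
  have hu_half : ∀ s, 1 / 2 ≤ ‖u s‖ := fun s => by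
    have := norm_sub_le (u s) (ψ s • (-Δ))
    have e1 : u s - ψ s • (-Δ) = U s := by simp [hu]
    rw [e1, hadm.unit] at this
    linarith [hsmall s]
  have hu_two : ∀ s, ‖u s‖ ≤ 2 := fun s => by
    have := norm_add_le (U s) (ψ s • (-Δ))
    rw [hadm.unit] at this
    linarith [hsmall s]
  have hu0 : ∀ s, u s ≠ 0 := fun s => norm_pos_iff.1 (by linarith [hu_half s])
  have hdir_out : ∀ s ∉ Ioo α β, direction u s = U s := fun s hs => by
    simp [direction, hu_out s hs, hadm.unit]
  have hulip : ∃ M, LipschitzWith M u := by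
    have h1 := ψlip.exists_smul (B := ‖Δ‖₊) (LipschitzWith.const (-Δ)) ψabs (fun s => by simp)
    obtain ⟨M, hM⟩ := hadm.lipschitz
    exact ⟨_, hM.add h1⟩
  obtain ⟨M, hM⟩ := hulip
  obtain ⟨B, hB⟩ := hadm.bounded
  obtain ⟨M', hM'⟩ := hadm.lipschitz
  have hadm' : IsAdmissible Λ L (T 0) (T L) (fun s => m s * ‖u s‖) (direction u) := by
    refine ⟨hadm.measurable.mul hM.continuous.norm.measurable,
      fun s => mul_nonneg (hadm.nonneg s) (norm_nonneg _),
      ⟨B * 2, fun s => mul_le_mul (hB s) (hu_two s) (norm_nonneg _) ((hadm.nonneg s).trans (hB s))⟩,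
      fun s => norm_direction (hu0 s), ⟨_, lipschitzWith_direction hM hu_half⟩, ?_,
      (hdir_out 0 fun hs => absurd hs.1 (not_lt.2 hα)).trans hadm.left,
      (hdir_out L fun hs => absurd hs.2 (not_lt.2 hβ)).trans hadm.right⟩
    filter_upwards [hM'.ae_differentiableAt_real, hadm.norm_deriv_le] with s hs hder hs0L
    have hud : HasDerivAt u (deriv U s + deriv ψ s • (-Δ)) s :=
      hs.hasDerivAt.add ((ψd s).hasDerivAt.smul_const _)
    refine (norm_deriv_direction_le hud.differentiableAt (hu0 s)).trans ?_
    rw [hud.deriv, div_le_iff₀ (norm_pos_iff.2 (hu0 s))]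
    by_cases hsI : s ∈ Ioo α β
    · have e0 : deriv U s = 0 := by
        have : U =ᶠ[𝓝 s] fun _ => e := by
          filter_upwards [Ioo_mem_nhds hsI.1 hsI.2] with r hr using (hmU r hr).2
        rw [this.deriv_eq]; simp
      rw [e0, zero_add, norm_smul, norm_neg, (hmU s hsI).1, Real.norm_eq_abs]
      have h1 := mul_le_mul_of_nonneg_right (ψK' s) (norm_nonneg Δ)
      have h2 : 1 / 4 ≤ ‖u s‖ * ‖u s‖ := by nlinarith [hu_half s]
      have h3 := mul_le_mul_of_nonneg_left h2 hΛ.le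
      linarith
    · rw [(ψout s hsI).2, hu_out s hsI, hadm.unit]
      simpa using hder hs0L
  have hmψ : ∀ s, m s * ψ s = ψ s := fun s => by
    by_cases hs : s ∈ Ioo α β
    · rw [(hmU s hs).1, one_mul]
    · rw [(ψout s hs).1, mul_zero]
  have hle := h.le_integral _ _ hadm' (by
    have e : ∀ s, (m s * ‖u s‖) • direction u s = m s • U s + ψ s • (-Δ) := fun s => by
      rw [mul_smul, norm_smul_direction (hu0 s), hu, smul_add, smul_smul, hmψ]
    have i1 : IntervalIntegrable (fun s => ψ s • (-Δ)) volume 0 L :=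
      Continuous.intervalIntegrable (by fun_prop) _ _
    simp_rw [e]
    rw [intervalIntegral.integral_add (hadm.intervalIntegrable_smul _ _) i1,
      intervalIntegral.integral_smul_const, ψint, hΔ]
    simp)
  have hpt : ∀ s, m s * ‖u s‖ ≤ m s + ψ s * (-⟪e, Δ⟫ + K / 2 * ‖Δ‖ ^ 2) := fun s => by
    by_cases hs : s ∈ Ioo α β
    · rw [(hmU s hs).1, one_mul]
      have h1 : ‖u s‖ ^ 2 = 1 - 2 * (ψ s * ⟪e, Δ⟫) + (ψ s * ‖Δ‖) ^ 2 := by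
        rw [hu, norm_add_sq_real, hadm.unit, (hmU s hs).2, norm_smul, norm_neg,
          real_inner_smul_right, inner_neg_right, Real.norm_of_nonneg (ψ0 s)]
        ring
      have h2 : |ψ s * ⟪e, Δ⟫| ≤ 1 / 2 := by
        have h3 := abs_real_inner_le_norm e Δ
        rw [he, one_mul] at h3
        rw [abs_mul, abs_of_nonneg (ψ0 s)]
        calc ψ s * |⟪e, Δ⟫| ≤ K * ‖Δ‖ := mul_le_mul (ψK s) h3 (abs_nonneg _) hK.le
          _ ≤ 1 / 2 := by linarith
      have h4 := (abs_le.1 h2).2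
      have h5 : ‖u s‖ ≤ 1 - ψ s * ⟪e, Δ⟫ + (ψ s * ‖Δ‖) ^ 2 / 2 := by
        refine abs_le_of_sq_le_sq' ?_ (by nlinarith [sq_nonneg (ψ s * ‖Δ‖)]) |>.2
        rw [h1]
        nlinarith [sq_nonneg (- (ψ s * ⟪e, Δ⟫) + (ψ s * ‖Δ‖) ^ 2 / 2)]
      have h6 : (ψ s * ‖Δ‖) ^ 2 ≤ ψ s * K * ‖Δ‖ ^ 2 := by
        have := mul_le_mul_of_nonneg_left (ψK s) (ψ0 s)
        nlinarith [sq_nonneg ‖Δ‖]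
      linarith
    · rw [(ψout s hs).1, hu_out s hs, hadm.unit]
      simp
  have i1 : IntervalIntegrable (fun s => ψ s * (-⟪e, Δ⟫ + K / 2 * ‖Δ‖ ^ 2)) volume 0 L :=
    Continuous.intervalIntegrable (by fun_prop) _ _
  have hmono := intervalIntegral.integral_mono_on hL.le (hadm'.intervalIntegrable 0 L)
    ((hadm.intervalIntegrable 0 L).add i1) (fun s _ => hpt s)
  rw [intervalIntegral.integral_add (hadm.intervalIntegrable 0 L) i1,
    intervalIntegral.integral_mul_const,
    ψint] at hmono
  linarith

end IsMinimalField

theorem norm_inv_smul_sub_le {n : ℕ} {t Y : Euc n} {B ε : ℝ} (ht : ‖t‖ = 1) (hY : ‖Y‖ ≤ B)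
    (hε : 0 < ε) (hεB : ε * B ≤ 1 / 4) :
    ‖‖t + ε • Y‖⁻¹ • (t + ε • Y) - t - ε • (Y - ⟪t, Y⟫ • t)‖ ≤ 4 * B ^ 2 * ε ^ 2 := by
  have hB : 0 ≤ B := (norm_nonneg _).trans hY
  set y := ⟪t, Y⟫ with hy
  set u := t + ε • Y with hu
  set ρ := ‖u‖ with hρ
  have hyB : |y| ≤ B := by
    have := abs_real_inner_le_norm t Y
    rw [ht, one_mul] at this
    exact this.trans hY
  have hεy : |ε * y| ≤ 1 / 4 := by
    rw [abs_mul, abs_of_pos hε]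
    exact (mul_le_mul_of_nonneg_left hyB hε.le).trans hεB
  obtain ⟨hy1, hy2⟩ := abs_le.1 hεy
  have hρ2 : ρ ^ 2 = 1 + 2 * (ε * y) + ε ^ 2 * ‖Y‖ ^ 2 := by
    rw [hρ, hu, norm_add_sq_real, ht, real_inner_smul_right, norm_smul, Real.norm_of_nonneg hε.le]
    ring
  have hY2 : ‖Y‖ ^ 2 ≤ B ^ 2 := pow_le_pow_left₀ (norm_nonneg _) hY 2
  have hyY : y ^ 2 ≤ ‖Y‖ ^ 2 := by
    have := abs_real_inner_le_norm t Y
    rw [ht, one_mul] at this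
    rw [← sq_abs y]; exact pow_le_pow_left₀ (abs_nonneg _) this 2
  have hρ1 : 1 + ε * y ≤ ρ := by
    have := real_inner_le_norm t u
    rwa [ht, one_mul, hu, inner_add_right, real_inner_self_eq_norm_sq, ht, real_inner_smul_right,
      one_pow] at this
  have hρ0 : 0 < ρ := by linarith
  have hρ3 : ρ - (1 + ε * y) ≤ B ^ 2 * ε ^ 2 := by
    have h1 : (ρ - (1 + ε * y)) * (ρ + (1 + ε * y)) = ε ^ 2 * (‖Y‖ ^ 2 - y ^ 2) := by
      linear_combination hρ2
    have h2 : ε ^ 2 * (‖Y‖ ^ 2 - y ^ 2) ≤ ε ^ 2 * B ^ 2 :=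
      mul_le_mul_of_nonneg_left (by nlinarith [sq_nonneg y]) (sq_nonneg _)
    nlinarith
  have e1 : ρ⁻¹ • u - t - ε • (Y - y • t)
      = (1 - ρ * (1 - ε * y)) • (ρ⁻¹ • u) - (ε ^ 2 * y) • Y := by
    have : ρ * (1 - ε * y) * ρ⁻¹ = 1 - ε * y := by field_simp
    rw [sub_smul, smul_smul (ρ * _), this, hu]
    module
  have h3 : ‖ρ⁻¹ • u‖ = 1 := by
    rw [norm_smul, norm_inv, norm_norm, inv_mul_cancel₀ hρ0.ne']
  have hsq : (ε * y) ^ 2 ≤ B ^ 2 * ε ^ 2 := by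
    have := mul_le_mul_of_nonneg_left (hyY.trans hY2) (sq_nonneg ε)
    nlinarith
  have h4 : |1 - ρ * (1 - ε * y)| ≤ 2 * (B ^ 2 * ε ^ 2) := by
    have : 1 - ρ * (1 - ε * y) = (ε * y) ^ 2 - (ρ - (1 + ε * y)) * (1 - ε * y) := by ring
    rw [this, abs_le]
    have h5 : 0 ≤ (ρ - (1 + ε * y)) * (1 - ε * y) := mul_nonneg (by linarith) (by linarith)
    have h6 : (ρ - (1 + ε * y)) * (1 - ε * y) ≤ B ^ 2 * ε ^ 2 * 2 :=
      mul_le_mul hρ3 (by linarith) (by linarith) (by positivity)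
    constructor <;> nlinarith [sq_nonneg (ε * y)]
  have h5 : ‖(ε ^ 2 * y) • Y‖ ≤ B ^ 2 * ε ^ 2 := by
    rw [norm_smul, norm_mul, Real.norm_of_nonneg (sq_nonneg ε), Real.norm_eq_abs, mul_assoc]
    have := mul_le_mul hyB hY (norm_nonneg _) hB
    nlinarith [sq_nonneg ε]
  rw [e1]
  refine (norm_sub_le _ _).trans ?_
  rw [norm_smul, h3, mul_one, Real.norm_eq_abs]
  nlinarith [mul_nonneg (sq_nonneg B) (sq_nonneg ε)]

/-- Estimates for the variation of a unit vector `t` (with velocity `D`) in direction `Y` (with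
velocity `E`), together with the arclength density which keeps the curvature bound. -/
theorem variation_estimates {n : ℕ} {Λ B ε : ℝ} {e t D Y E : Euc n} (hΛ : 0 < Λ) (he : ‖e‖ = 1)
    (ht : ‖t‖ = 1) (hD : ‖D‖ ≤ Λ) (hY : ‖Y‖ ≤ B) (hE : ‖E‖ ≤ B) (hB : 1 ≤ B)
    (hQ : |⟪D, E⟫ / Λ ^ 2 - ⟪t, Y⟫| ≤ B) (hε : 0 < ε) (hεB : ε * B ≤ 1 / 4)
    {K m : ℝ} (hK : K = 2 * B ^ 2 + B ^ 2 / Λ ^ 2)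
    (hm : m = 1 + (ε * (⟪D, E⟫ / Λ ^ 2 - ⟪t, Y⟫) + K * ε ^ 2)) :
    0 ≤ m ∧ m ≤ 2 + K ∧ ‖D + ε • E‖ ≤ Λ * m * ‖t + ε • Y‖ ∧
    ‖m • (‖t + ε • Y‖⁻¹ • (t + ε • Y)) - t‖ ≤ (4 * B + K) * ε ∧
    m - 1 - ⟪e, m • (‖t + ε • Y‖⁻¹ • (t + ε • Y)) - t⟫ ≤
      ε * (⟪((1 - ⟪e, t⟫) / Λ ^ 2) • D, E⟫ - ⟪Y, e + (1 - 2 * ⟪e, t⟫) • t⟫)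
        + (2 * K + 3 * B * (B + K) + 4 * B ^ 2) * ε ^ 2 := by
  have hR := norm_inv_smul_sub_le ht hY hε hεB
  set y := ⟪t, Y⟫ with hy
  set x := ⟪e, t⟫ with hx
  set Q := ⟪D, E⟫ / Λ ^ 2 - y with hQdef
  set u := t + ε • Y with hu
  set ρ := ‖u‖ with hρ
  set U := ρ⁻¹ • u with hU
  set R := U - t - ε • (Y - y • t) with hRdef
  have hK0 : 0 ≤ K := by rw [hK]; positivity
  have hε1 : ε ≤ 1 := by nlinarith
  have hyB : |y| ≤ B := by
    have := abs_real_inner_le_norm t Y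
    rw [ht, one_mul] at this
    exact this.trans hY
  have hxabs : |x| ≤ 1 := by
    have := abs_real_inner_le_norm e t
    rwa [he, ht, one_mul] at this
  obtain ⟨hx1, hx2⟩ := abs_le.1 hxabs
  have hεQ : |ε * Q| ≤ ε * B := by
    rw [abs_mul, abs_of_pos hε]; exact mul_le_mul_of_nonneg_left hQ hε.le
  have hεy : |ε * y| ≤ ε * B := by
    rw [abs_mul, abs_of_pos hε]; exact mul_le_mul_of_nonneg_left hyB hε.le
  have hKε : K * ε ^ 2 ≤ K * ε :=
    mul_le_mul_of_nonneg_left (by rw [sq]; exact mul_le_of_le_one_left hε.le hε1) hK0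
  have hm1 : |m - 1| ≤ (B + K) * ε := by
    rw [hm, add_sub_cancel_left]
    refine (abs_add_le _ _).trans ?_
    rw [abs_of_nonneg (mul_nonneg hK0 (sq_nonneg ε))]
    linarith
  have hUt : U - t = ε • (Y - y • t) + R := by rw [hRdef]; abel
  have hUt' : ‖U - t‖ ≤ 3 * B * ε := by
    rw [hUt]
    refine (norm_add_le _ _).trans ?_
    rw [norm_smul, Real.norm_of_nonneg hε.le]
    have h1 : ‖Y - y • t‖ ≤ 2 * B := by
      refine (norm_sub_le _ _).trans ?_
      rw [norm_smul, ht, mul_one, Real.norm_eq_abs]; linarith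
    have h2 := mul_le_mul_of_nonneg_left hεB (by positivity : 0 ≤ 4 * (B * ε))
    have h3 := mul_le_mul_of_nonneg_left h1 hε.le
    linarith
  have hu0 : 3 / 4 ≤ ρ := by
    have := norm_sub_le u (ε • Y)
    rw [hu, add_sub_cancel_right, ht, norm_smul, Real.norm_of_nonneg hε.le] at this
    have h2 := mul_le_mul_of_nonneg_left hY hε.le
    linarith
  have hU1 : ‖U‖ = 1 := by
    rw [hU, norm_smul, norm_inv, norm_norm, inv_mul_cancel₀ (by linarith)]
  have hm0 : 0 ≤ m := by
    rw [hm]; linarith [(abs_le.1 hεQ).1, mul_nonneg hK0 (sq_nonneg ε)]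
  refine ⟨hm0, ?_, ?_, ?_, ?_⟩
  · rw [hm]
    have : K * ε ≤ K := mul_le_of_le_one_right hK0 hε1
    linarith [(abs_le.1 hεQ).2]
  · have hρ1 : 1 + ε * y ≤ ρ := by
      have := real_inner_le_norm t u
      rwa [ht, one_mul, hu, inner_add_right, real_inner_self_eq_norm_sq, ht,
        real_inner_smul_right, one_pow] at this
    have h1 : ‖D + ε • E‖ ≤ Λ * (1 + ε * (Q + y) + ε ^ 2 * (B ^ 2 / (2 * Λ ^ 2))) := by
      have e1 : Λ * (1 + ε * (Q + y) + ε ^ 2 * (B ^ 2 / (2 * Λ ^ 2)))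
          = (2 * Λ)⁻¹ * (2 * Λ ^ 2 + 2 * ε * ⟪D, E⟫ + ε ^ 2 * B ^ 2) := by
        rw [hQdef]; field_simp; ring
      have h2 : ‖D + ε • E‖ ^ 2 = ‖D‖ ^ 2 + 2 * ε * ⟪D, E⟫ + ε ^ 2 * ‖E‖ ^ 2 := by
        rw [norm_add_sq_real, real_inner_smul_right, norm_smul, Real.norm_of_nonneg hε.le]; ring
      have h3 : ‖D‖ ^ 2 ≤ Λ ^ 2 := pow_le_pow_left₀ (norm_nonneg _) hD 2
      have h4 : ‖E‖ ^ 2 ≤ B ^ 2 := pow_le_pow_left₀ (norm_nonneg _) hE 2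
      have h5 := mul_le_mul_of_nonneg_left h4 (sq_nonneg ε)
      have h6 := sq_nonneg (‖D + ε • E‖ - Λ)
      rw [e1, inv_mul_eq_div, le_div_iff₀ (by positivity)]
      linarith
    refine h1.trans ?_
    rw [mul_assoc]
    refine mul_le_mul_of_nonneg_left ?_ hΛ.le
    refine le_trans ?_ (mul_le_mul_of_nonneg_left hρ1 hm0)
    have e2 : m * (1 + ε * y) = 1 + ε * (Q + y) + ε ^ 2 * (K + Q * y + K * (ε * y)) := by
      rw [hm]; ring
    rw [e2]
    have h6 : |Q * y| ≤ B ^ 2 := by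
      rw [abs_mul, sq]; exact mul_le_mul hQ hyB (abs_nonneg _) (by linarith)
    have h7 : B ^ 2 / (2 * Λ ^ 2) = B ^ 2 / Λ ^ 2 / 2 := by field_simp
    have h8 : 0 ≤ B ^ 2 / Λ ^ 2 := by positivity
    have h10 : 0 ≤ B ^ 2 := sq_nonneg B
    have h9 : B ^ 2 / (2 * Λ ^ 2) ≤ K + Q * y + K * (ε * y) := by
      rw [h7]
      have : -(1 / 4) ≤ ε * y := by linarith [(abs_le.1 hεy).1]
      have := mul_le_mul_of_nonneg_left this hK0
      linarith [(abs_le.1 h6).1]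
    have := mul_le_mul_of_nonneg_left h9 (sq_nonneg ε)
    linarith
  · have e1 : m • U - t = (m - 1) • U + (U - t) := by module
    rw [e1]
    refine (norm_add_le _ _).trans ?_
    rw [norm_smul, hU1, mul_one, Real.norm_eq_abs]
    linarith
  · have e1 : m • U - t = (m - 1) • t + (m - 1) • (U - t) + (U - t) := by module
    have e2 : ⟪e, U - t⟫ = ε * (⟪e, Y⟫ - y * x) + ⟪e, R⟫ := by
      rw [hUt, inner_add_right, real_inner_smul_right, inner_sub_right, real_inner_smul_right]
    have e3 : ⟪Y, e + (1 - 2 * x) • t⟫ = ⟪e, Y⟫ + (1 - 2 * x) * y := by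
      rw [inner_add_right, real_inner_smul_right, real_inner_comm, real_inner_comm t Y]
    have e4 : ⟪((1 - x) / Λ ^ 2) • D, E⟫ = (1 - x) * (Q + y) := by
      rw [real_inner_smul_left, hQdef]; ring
    have h1 : |⟪e, R⟫| ≤ 4 * B ^ 2 * ε ^ 2 := by
      have := abs_real_inner_le_norm e R
      rw [he, one_mul] at this
      exact this.trans hR
    have h2 : |(m - 1) * ⟪e, U - t⟫| ≤ (B + K) * ε * (3 * B * ε) := by
      have := abs_real_inner_le_norm e (U - t)
      rw [he, one_mul] at this
      rw [abs_mul]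
      exact mul_le_mul hm1 (this.trans hUt') (abs_nonneg _) (by positivity)
    have h3 : K * ε ^ 2 * (1 - x) ≤ 2 * K * ε ^ 2 := by
      have := mul_le_mul_of_nonneg_left (by linarith : 1 - x ≤ 2) (mul_nonneg hK0 (sq_nonneg ε))
      linarith
    have e5 : m - 1 - ⟪e, m • U - t⟫ = (ε * Q + K * ε ^ 2) * (1 - x) - (m - 1) * ⟪e, U - t⟫
        - (ε * (⟪e, Y⟫ - y * x) + ⟪e, R⟫) := by
      rw [e1, inner_add_right, inner_add_right, real_inner_smul_right, real_inner_smul_right, ← e2,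
        hm]
      ring
    rw [e5, e3, e4]
    have := (abs_le.1 h1).1
    have := (abs_le.1 h2).1
    linarith

namespace IsMinimalField

variable {n : ℕ} {Λ L : ℝ} {T : ℝ → Euc n}

/-- The first variation of length, relative to a straight piece in direction `e`, is
nonnegative. -/
theorem first_variation (h : IsMinimalField Λ L T) {α β : ℝ} {e : Euc n} (hα : 0 ≤ α)
    (hαβ : α < β) (hβ : β ≤ L) (he : ‖e‖ = 1) {m : ℝ → ℝ → ℝ} {U : ℝ → ℝ → Euc n} {f : ℝ → ℝ}
    {ε₀ K₁ K₂ : ℝ} (hε₀ : 0 < ε₀)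
    (hadm : ∀ ε ∈ Ioo 0 ε₀, IsAdmissible Λ L (T 0) (T L) (m ε) (U ε))
    (hmU : ∀ ε ∈ Ioo 0 ε₀, ∀ s ∈ Ioo α β, m ε s = 1 ∧ U ε s = e)
    (hf : IntervalIntegrable f volume 0 L)
    (h1 : ∀ ε ∈ Ioo 0 ε₀, ∀ s, ‖m ε s • U ε s - T s‖ ≤ K₁ * ε)
    (h2 : ∀ ε ∈ Ioo 0 ε₀, ∀ s, m ε s - 1 - ⟪e, m ε s • U ε s - T s⟫ ≤ ε * f s + K₂ * ε ^ 2) :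
    0 ≤ ∫ s in 0..L, f s := by
  obtain ⟨C, r, hr, hC⟩ := h.exists_compensation hα hαβ hβ he
  have hL := h.length_pos
  have key : ∀ᶠ ε in 𝓝[>] (0 : ℝ), 0 ≤ (∫ s in 0..L, f s) + (K₂ * L + |C| * (K₁ * L) ^ 2) * ε := by
    have hsmall : ∀ᶠ ε in 𝓝[>] (0 : ℝ), K₁ * ε * L < r := by
      refine Filter.Eventually.filter_mono nhdsWithin_le_nhds ?_
      have : Tendsto (fun ε : ℝ => K₁ * ε * L) (𝓝 0) (𝓝 (K₁ * 0 * L)) :=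
        Continuous.tendsto (by fun_prop) _
      exact this.eventually_lt_const (by simpa using hr)
    filter_upwards [Ioo_mem_nhdsGT hε₀, hsmall] with ε hε hεr
    have ha := hadm ε hε
    have i1 := ha.intervalIntegrable_smul 0 L
    have i2 : IntervalIntegrable T volume 0 L := h.continuous.intervalIntegrable _ _
    have i3 := ha.intervalIntegrable 0 L
    set Δ : Euc n := (∫ s in 0..L, m ε s • U ε s) - ∫ s in 0..L, T s with hΔ
    have hΔ' : Δ = ∫ s in 0..L, (m ε s • U ε s - T s) :=
      (intervalIntegral.integral_sub i1 i2).symm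
    have hΔn : ‖Δ‖ ≤ K₁ * ε * L := by
      rw [hΔ']
      have := intervalIntegral.norm_integral_le_of_norm_le_const (a := 0) (b := L)
        (C := K₁ * ε) fun s _ => h1 ε hε s
      rwa [sub_zero, abs_of_pos hL] at this
    have hcomp := hC _ _ ha (hmU ε hε) Δ hΔ (hΔn.trans hεr.le)
    have hin : ∫ s in 0..L, ⟪e, m ε s • U ε s - T s⟫ = ⟪e, Δ⟫ := by
      rw [hΔ']
      have := (innerSL ℝ e).intervalIntegral_comp_comm (i1.sub i2)
      simpa only [innerSL_apply_apply] using this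
    have i4 : IntervalIntegrable (fun s => ⟪e, m ε s • U ε s - T s⟫) volume 0 L :=
      ⟨(innerSL ℝ e).integrable_comp (i1.sub i2).1, (innerSL ℝ e).integrable_comp (i1.sub i2).2⟩
    have i5 : IntervalIntegrable (fun s => m ε s - 1) volume 0 L := i3.sub intervalIntegrable_const
    have i6 : IntervalIntegrable (fun s => ε * f s) volume 0 L := hf.const_mul _
    have hmono := intervalIntegral.integral_mono_on hL.le (i5.sub i4)
      (i6.add (intervalIntegrable_const (c := K₂ * ε ^ 2))) fun s _ => h2 ε hε s
    rw [intervalIntegral.integral_sub i5 i4, hin,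
      intervalIntegral.integral_sub i3 intervalIntegrable_const,
      intervalIntegral.integral_add i6 intervalIntegrable_const,
      intervalIntegral.integral_const_mul] at hmono
    simp only [intervalIntegral.integral_const, smul_eq_mul, sub_zero, mul_one] at hmono
    have hsq : C * ‖Δ‖ ^ 2 ≤ |C| * (K₁ * ε * L) ^ 2 :=
      mul_le_mul (le_abs_self C) (pow_le_pow_left₀ (norm_nonneg _) hΔn 2) (sq_nonneg _)
        (abs_nonneg C)
    have : 0 ≤ ε * ((∫ s in 0..L, f s) + (K₂ * L + |C| * (K₁ * L) ^ 2) * ε) := by nlinarith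
    exact nonneg_of_mul_nonneg_right this hε.1
  have hlim : Tendsto (fun ε : ℝ => (∫ s in 0..L, f s) + (K₂ * L + |C| * (K₁ * L) ^ 2) * ε)
      (𝓝[>] 0) (𝓝 ((∫ s in 0..L, f s) + (K₂ * L + |C| * (K₁ * L) ^ 2) * 0)) :=
    (Continuous.tendsto (by fun_prop) _).mono_left nhdsWithin_le_nhds
  rw [mul_zero, add_zero] at hlim
  exact ge_of_tendsto hlim key

/-- Away from the direction of a straight piece, the curvature of a minimizer is maximal. -/
theorem ae_norm_deriv_eq (h : IsMinimalField Λ L T) {α β : ℝ} {e : Euc n} (hα : 0 ≤ α)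
    (hαβ : α < β) (hβ : β ≤ L) (he : ‖e‖ = 1) (hT : ∀ s ∈ Ioo α β, T s = e) :
    ∀ᵐ s, s ∈ Ioc 0 L → T s ≠ e → ‖deriv T s‖ = Λ := by
  have hΛ := h.pos
  have hL := h.length_pos
  set S : Set ℝ := {s | T s ≠ e} with hS
  have hSm : MeasurableSet S := (isOpen_ne_fun h.continuous continuous_const).measurableSet
  set χ : ℝ → ℝ := S.indicator fun s => 1 - ‖deriv T s‖ / Λ with hχ
  have hχm : Measurable χ :=
    (measurable_const.sub (h.measurable_deriv.norm.div_const Λ)).indicator hSm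
  have hχin : ∀ s, T s ≠ e → χ s = 1 - ‖deriv T s‖ / Λ := fun s hs => indicator_of_mem hs _
  have hχout : ∀ s, T s = e → χ s = 0 := fun s hs => indicator_of_notMem (by simpa [hS] using hs) _
  have hχ01 : ∀ s, 0 ≤ χ s ∧ χ s ≤ 1 := fun s => by
    by_cases hs : T s = e
    · simp [hχout s hs]
    · rw [hχin s hs]
      have h1 : ‖deriv T s‖ / Λ ≤ 1 := (div_le_one hΛ).2 (h.norm_deriv_le s)
      have h2 : 0 ≤ ‖deriv T s‖ / Λ := by positivity
      constructor <;> linarith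
  have hx : ∀ s, ⟪e, T s⟫ ≤ 1 ∧ -1 ≤ ⟪e, T s⟫ := fun s => by
    have := abs_real_inner_le_norm e (T s)
    rw [he, h.unit, one_mul] at this
    exact ⟨(abs_le.1 this).2, (abs_le.1 this).1⟩
  have hTc := h.continuous
  have hfi : IntervalIntegrable (fun s => -(χ s * (1 - ⟪e, T s⟫))) volume 0 L := by
    refine intervalIntegrable_of_norm_le (M := 2) ?_ (fun s => ?_) _ _
    · have : Measurable fun s => 1 - ⟪e, T s⟫ := Continuous.measurable (by fun_prop)
      exact (hχm.mul this).neg.aestronglyMeasurable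
    · rw [norm_neg, norm_mul, Real.norm_of_nonneg (hχ01 s).1,
        Real.norm_of_nonneg (by linarith [(hx s).1])]
      have := mul_le_mul (hχ01 s).2 (by linarith [hx s] : 1 - ⟪e, T s⟫ ≤ 2)
        (by linarith [(hx s).1]) zero_le_one
      linarith
  have hvar := h.first_variation (m := fun ε s => 1 - ε * χ s) (U := fun _ => T)
    (f := fun s => -(χ s * (1 - ⟪e, T s⟫))) (ε₀ := 1) (K₁ := 1) (K₂ := 0) hα hαβ hβ he one_pos
    (fun ε hε => ⟨measurable_const.sub (hχm.const_mul _), fun s => ?_, ⟨1, fun s => ?_⟩, h.unit,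
      ⟨_, h.lipschitz⟩, ae_of_all _ fun s _ => ?_, rfl, rfl⟩)
    (fun ε _ s hs => ⟨by simp [hχout s (hT s hs)], hT s hs⟩) hfi (fun ε hε s => ?_)
    (fun ε hε s => ?_)
  · have hnn : ∀ s, 0 ≤ χ s * (1 - ⟪e, T s⟫) := fun s =>
      mul_nonneg (hχ01 s).1 (by linarith [(hx s).1])
    rw [intervalIntegral.integral_neg] at hvar
    have h0 := intervalIntegral.integral_nonneg (μ := volume) hL.le fun s _ => hnn s
    have hz : ∫ s in 0..L, χ s * (1 - ⟪e, T s⟫) = 0 := by linarith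
    have hfi' : IntervalIntegrable (fun s => χ s * (1 - ⟪e, T s⟫)) volume 0 L := by
      simpa only [Pi.neg_def, neg_neg] using hfi.neg
    rw [intervalIntegral.integral_eq_zero_iff_of_le_of_nonneg_ae hL.le
      (ae_of_all _ hnn) hfi'] at hz
    filter_upwards [(ae_restrict_iff' measurableSet_Ioc).1 hz] with s hs hsL hse
    rcases mul_eq_zero.1 (hs hsL) with h1 | h1
    · rw [hχin s hse, sub_eq_zero, eq_comm, div_eq_one_iff_eq hΛ.ne'] at h1
      exact h1
    · exact absurd ((inner_eq_one_iff_of_norm_eq_one (𝕜 := ℝ) he (h.unit s)).1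
        (by linarith)).symm hse
  · have := mul_le_mul hε.2.le (hχ01 s).2 (hχ01 s).1 zero_le_one
    linarith
  · linarith [mul_nonneg hε.1.le (hχ01 s).1]
  · by_cases hs : T s = e
    · simpa [hχout s hs] using h.norm_deriv_le s
    · rw [hχin s hs]
      have e1 : Λ * (1 - ε * (1 - ‖deriv T s‖ / Λ)) = Λ - ε * (Λ - ‖deriv T s‖) := by field_simp
      rw [e1]
      nlinarith [h.norm_deriv_le s, hε.2]
  · have e1 : (1 - ε * χ s) • T s - T s = -((ε * χ s) • T s) := by module
    rw [e1, norm_neg, norm_smul, h.unit, mul_one, one_mul,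
      Real.norm_of_nonneg (mul_nonneg hε.1.le (hχ01 s).1)]
    exact mul_le_of_le_one_right hε.1.le (hχ01 s).2
  · have e1 : (1 - ε * χ s) • T s - T s = (-(ε * χ s)) • T s := by module
    rw [e1, real_inner_smul_right]
    apply le_of_eq; ring

/-- The first variation formula for a velocity variation `E` supported away from a straight
piece of direction `e`. -/
theorem variation_nonneg (h : IsMinimalField Λ L T) {α β a b : ℝ} {e : Euc n} (hα : 0 ≤ α)
    (hαβ : α < β) (hβ : β ≤ L) (he : ‖e‖ = 1) (hT : ∀ s ∈ Ioo α β, T s = e) (ha : 0 ≤ a)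
    (hb : b ≤ L) (hdisj : Disjoint (Ioo α β) (Ioc a b)) {E : ℝ → Euc n}
    (hEm : Measurable E) {M : NNReal} (hEM : ∀ s, ‖E s‖ ≤ M) (hE : ∀ s ∉ Ioc a b, E s = 0)
    (hE0 : ∫ s in 0..L, E s = 0) :
    0 ≤ ∫ s in 0..L, (⟪((1 - ⟪e, T s⟫) / Λ ^ 2) • deriv T s, E s⟫
      - ⟪∫ r in 0..s, E r, e + (1 - 2 * ⟪e, T s⟫) • T s⟫) := by
  have hΛ := h.pos
  have hL := h.length_pos
  have hTc := h.continuous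
  have hDm := h.measurable_deriv
  have hEi : ∀ x y, IntervalIntegrable E volume x y :=
    intervalIntegrable_of_norm_le hEm.aestronglyMeasurable hEM
  set Y : ℝ → Euc n := fun s => ∫ r in 0..s, E r with hY
  have hYlip : LipschitzWith M Y := lipschitzWith_primitive hEm.aestronglyMeasurable hEM 0
  have hYder := ae_hasDerivAt_primitive hEm.aestronglyMeasurable hEM 0
  have hYc := hYlip.continuous
  have hzero : ∀ x y, (∀ r ∈ uIoc x y, r ∉ Ioc a b) → ∫ r in x..y, E r = 0 := fun x y hxy => by
    rw [intervalIntegral.integral_congr_ae (g := fun _ => (0 : Euc n))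
      (ae_of_all _ fun r hr => hE r (hxy r hr)), intervalIntegral.integral_zero]
  have hYout : ∀ s ∉ Ioc a b, Y s = 0 := fun s hs => by
    rcases le_or_gt s a with hsa | hsa
    · exact hzero _ _ fun r hr hr' => absurd (hr.2.trans (max_le ha hsa)) (not_le.2 hr'.1)
    · have hsb : b < s := not_le.1 fun hsb => hs ⟨hsa, hsb⟩
      have h1 := intervalIntegral.integral_add_adjacent_intervals (hEi 0 L) (hEi L s)
      rw [hE0, zero_add, hzero L s fun r hr hr' =>
        absurd hr.1 (not_lt.2 (hr'.2.trans (le_min hb hsb.le)))] at h1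
      exact h1.symm
  have hYM : ∀ s, ‖Y s‖ ≤ M * L := fun s => by
    by_cases hs : s ∈ Ioc a b
    · have h1 := intervalIntegral.norm_integral_le_of_norm_le_const (a := 0) (b := s)
        (C := M) fun r _ => hEM r
      rw [sub_zero, abs_of_nonneg (ha.trans hs.1.le)] at h1
      exact h1.trans (mul_le_mul_of_nonneg_left (hs.2.trans hb) M.2)
    · rw [hYout s hs, norm_zero]; positivity
  set Q : ℝ → ℝ := fun s => ⟪deriv T s, E s⟫ / Λ ^ 2 - ⟪T s, Y s⟫ with hQ
  have hDE : ∀ s, |⟪deriv T s, E s⟫| ≤ Λ * M := fun s =>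
    (abs_real_inner_le_norm _ _).trans (mul_le_mul (h.norm_deriv_le s) (hEM s)
      (norm_nonneg _) hΛ.le)
  have hQM : ∀ s, |Q s| ≤ Λ * M / Λ ^ 2 + M * L := fun s => by
    refine (abs_sub _ _).trans (add_le_add ?_ ?_)
    · rw [abs_div, abs_of_nonneg (sq_nonneg Λ)]
      gcongr
      exact hDE s
    · have := abs_real_inner_le_norm (T s) (Y s)
      rw [h.unit, one_mul] at this
      exact this.trans (hYM s)
  have hQm : Measurable Q := by fun_prop
  obtain ⟨B, hB1, hBM, hBY, hBQ⟩ : ∃ B : ℝ, 1 ≤ B ∧ (M : ℝ) ≤ B ∧ M * L ≤ B ∧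
      Λ * M / Λ ^ 2 + M * L ≤ B := by
    have h0 : (0 : ℝ) ≤ M := M.2
    have h1 : 0 ≤ M * L := by positivity
    have h2 : 0 ≤ Λ * M / Λ ^ 2 := by positivity
    exact ⟨1 + M + M * L + Λ * M / Λ ^ 2, by linarith, by linarith, by linarith, by linarith⟩
  obtain ⟨K, hK⟩ : ∃ K : ℝ, K = 2 * B ^ 2 + B ^ 2 / Λ ^ 2 := ⟨_, rfl⟩
  have hK0 : 0 ≤ K := by rw [hK]; positivity
  set m : ℝ → ℝ → ℝ := fun ε s => 1 + (Ioc a b).indicator (fun s => ε * Q s + K * ε ^ 2) s with hm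
  have m_in : ∀ ε, ∀ s ∈ Ioc a b, m ε s = 1 + (ε * Q s + K * ε ^ 2) := fun ε s hs => by
    simp only [hm, indicator_of_mem hs]
  have m_out : ∀ ε, ∀ s ∉ Ioc a b, m ε s = 1 := fun ε s hs => by
    simp only [hm, indicator_of_notMem hs, add_zero]
  set u : ℝ → ℝ → Euc n := fun ε s => T s + ε • Y s with hu
  have u_out : ∀ ε, ∀ s ∉ Ioc a b, u ε s = T s := fun ε s hs => by simp [hu, hYout s hs]
  have U_out : ∀ ε, ∀ s ∉ Ioc a b, direction (u ε) s = T s := fun ε s hs => by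
    simp [direction, u_out ε s hs, h.unit]
  have hest := fun ε (hε : ε ∈ Ioo 0 (1 / (4 * B))) (s : ℝ) (hs : s ∈ Ioc a b) =>
    variation_estimates hΛ he (h.unit s) (h.norm_deriv_le s) ((hYM s).trans hBY)
      ((hEM s).trans hBM) hB1 ((hQM s).trans hBQ) hε.1 (by
        have := hε.2.le
        rw [le_div_iff₀ (by positivity)] at this
        linarith) hK (m_in ε s hs)
  have hεB : ∀ ε ∈ Ioo 0 (1 / (4 * B)), ε * B ≤ 1 / 4 := fun ε hε => by
    have := hε.2.le
    rw [le_div_iff₀ (by positivity)] at this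
    linarith
  have u_half : ∀ ε ∈ Ioo 0 (1 / (4 * B)), ∀ s, 1 / 2 ≤ ‖u ε s‖ := fun ε hε s => by
    have h1 := norm_sub_le (u ε s) (ε • Y s)
    simp only [hu, add_sub_cancel_right, h.unit, norm_smul, Real.norm_of_nonneg hε.1.le] at h1
    have h2 := mul_le_mul_of_nonneg_left ((hYM s).trans hBY) hε.1.le
    linarith [hεB ε hε]
  have ulip : ∀ ε, ∃ C, LipschitzWith C (u ε) := fun ε =>
    ⟨_, h.lipschitz.add ((lipschitzWith_smul ε).comp hYlip)⟩
  have hadm : ∀ ε ∈ Ioo 0 (1 / (4 * B)),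
      IsAdmissible Λ L (T 0) (T L) (m ε) (direction (u ε)) := fun ε hε => by
    obtain ⟨C, hC⟩ := ulip ε
    have u0 : ∀ s, u ε s ≠ 0 := fun s => norm_pos_iff.1 (by linarith [u_half ε hε s])
    have hd : ∀ s, s ∉ Ioo a b → direction (u ε) s = T s := fun s hs => by
      by_cases hs' : s ∈ Ioc a b
      · have hsb : s = b := le_antisymm hs'.2 (not_lt.1 fun hb => hs ⟨hs'.1, hb⟩)
        have h1 := intervalIntegral.integral_add_adjacent_intervals (hEi 0 L) (hEi L s)
        rw [hE0, zero_add, hzero L s fun r hr hr' => absurd hr.1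
          (not_lt.2 (hr'.2.trans (le_min hb hsb.ge)))] at h1
        simp [direction, hu, hY, ← h1, h.unit]
      · exact U_out ε s hs'
    refine ⟨measurable_const.add (((hQm.const_mul ε).add_const _).indicator measurableSet_Ioc),
      fun s => ?_, ⟨2 + K, fun s => ?_⟩, fun s => norm_direction (u0 s),
      ⟨_, lipschitzWith_direction hC (u_half ε hε)⟩, ?_,
      hd 0 fun hs => absurd hs.1 (not_lt.2 ha), hd L fun hs => absurd hs.2 (not_lt.2 hb)⟩
    · by_cases hs : s ∈ Ioc a b
      · exact (hest ε hε s hs).1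
      · rw [m_out ε s hs]; exact zero_le_one
    · by_cases hs : s ∈ Ioc a b
      · exact (hest ε hε s hs).2.1
      · rw [m_out ε s hs]; linarith
    · filter_upwards [h.lipschitz.ae_differentiableAt_real, hYder] with s hs1 hs2 _
      have hud : HasDerivAt (u ε) (deriv T s + ε • E s) s :=
        hs1.hasDerivAt.add (hs2.const_smul ε)
      refine (norm_deriv_direction_le hud.differentiableAt (u0 s)).trans ?_
      rw [hud.deriv, div_le_iff₀ (norm_pos_iff.2 (u0 s))]
      by_cases hs : s ∈ Ioc a b
      · exact (hest ε hε s hs).2.2.1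
      · rw [hE s hs, m_out ε s hs, u_out ε s hs, h.unit]
        simpa using h.norm_deriv_le s
  refine h.first_variation (m := m) (U := fun ε => direction (u ε)) (K₁ := 4 * B + K)
    (K₂ := 2 * K + 3 * B * (B + K) + 4 * B ^ 2) hα hαβ hβ he
    (by positivity : 0 < 1 / (4 * B)) hadm (fun ε _ s hs => ?_) ?_ (fun ε hε s => ?_)
    (fun ε hε s => ?_)
  · have hs' : s ∉ Ioc a b := fun h' => disjoint_left.1 hdisj hs h'
    exact ⟨m_out ε s hs', (U_out ε s hs').trans (hT s hs)⟩
  · have hfm : Measurable fun s => ⟪((1 - ⟪e, T s⟫) / Λ ^ 2) • deriv T s, E s⟫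
        - ⟪Y s, e + (1 - 2 * ⟪e, T s⟫) • T s⟫ := by fun_prop
    refine intervalIntegrable_of_norm_le (M := 2 / Λ ^ 2 * (Λ * M) + M * L * 4)
      hfm.aestronglyMeasurable (fun s => ?_) _ _
    have hx := abs_real_inner_le_norm e (T s)
    rw [he, h.unit, one_mul] at hx
    obtain ⟨hx1, hx2⟩ := abs_le.1 hx
    refine (norm_sub_le _ _).trans (add_le_add ?_ ?_)
    · rw [real_inner_smul_left, norm_mul, norm_div, Real.norm_of_nonneg (sq_nonneg Λ),
        Real.norm_of_nonneg (by linarith)]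
      have := hDE s
      rw [Real.norm_eq_abs]
      gcongr
      linarith
    · refine (norm_inner_le_norm _ _).trans (mul_le_mul (hYM s) ?_ (norm_nonneg _) (by positivity))
      refine (norm_add_le _ _).trans ?_
      rw [he, norm_smul, h.unit, mul_one, Real.norm_eq_abs]
      have : |1 - 2 * ⟪e, T s⟫| ≤ 3 := abs_le.2 ⟨by linarith, by linarith⟩
      linarith
  · by_cases hs : s ∈ Ioc a b
    · exact (hest ε hε s hs).2.2.2.1
    · simp only [m_out ε s hs, U_out ε s hs, one_smul, sub_self, norm_zero]
      have := hε.1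
      positivity
  · by_cases hs : s ∈ Ioc a b
    · exact (hest ε hε s hs).2.2.2.2
    · have hYs := hYout s hs
      simp only [hY] at hYs
      simp only [m_out ε s hs, U_out ε s hs, hE s hs, hYs, one_smul, sub_self, inner_zero_right,
        inner_zero_left, mul_zero, zero_add]
      have := hε.1
      positivity

end IsMinimalField

theorem LipschitzWith.integral_inner_deriv_add {n : ℕ} {Y H Y' H' : ℝ → Euc n} {K M : NNReal}
    (hY : LipschitzWith K Y) (hH : LipschitzWith M H) {a b : ℝ}
    (hY' : ∀ᵐ s, HasDerivAt Y (Y' s) s) (hH' : ∀ᵐ s, HasDerivAt H (H' s) s) :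
    ∫ s in a..b, (⟪Y s, H' s⟫ + ⟪Y' s, H s⟫) = ⟪Y b, H b⟫ - ⟪Y a, H a⟫ := by
  obtain ⟨B, hB⟩ := (isCompact_uIcc (a := a) (b := b)).exists_bound_of_continuousOn
    hY.continuous.continuousOn
  obtain ⟨C, hC⟩ := (isCompact_uIcc (a := a) (b := b)).exists_bound_of_continuousOn
    hH.continuous.continuousOn
  have hB0 : 0 ≤ B := (norm_nonneg _).trans (hB a left_mem_uIcc)
  have hC0 : 0 ≤ C := (norm_nonneg _).trans (hC a left_mem_uIcc)
  have hl : LipschitzOnWith (B.toNNReal * M + K * C.toNNReal) (fun s => ⟪Y s, H s⟫) (uIcc a b) := by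
    refine LipschitzOnWith.of_dist_le_mul fun x hx y hy => ?_
    have e : ⟪Y x, H x⟫ - ⟪Y y, H y⟫ = ⟪Y x, H x - H y⟫ + ⟪Y x - Y y, H y⟫ := by
      rw [inner_sub_right, inner_sub_left]; ring
    have h1 := hY.dist_le_mul x y
    have h2 := hH.dist_le_mul x y
    rw [dist_eq_norm] at h1 h2 ⊢
    rw [e]
    refine (norm_add_le _ _).trans ?_
    have h3 := (norm_inner_le_norm (𝕜 := ℝ) (Y x) (H x - H y)).trans
      (mul_le_mul (hB x hx) h2 (norm_nonneg _) hB0)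
    have h4 := (norm_inner_le_norm (𝕜 := ℝ) (Y x - Y y) (H y)).trans
      (mul_le_mul h1 (hC y hy) (norm_nonneg _) (by positivity))
    push_cast
    rw [Real.coe_toNNReal _ hB0, Real.coe_toNNReal _ hC0]
    linarith
  rw [← hl.absolutelyContinuousOnInterval.integral_deriv_eq_sub]
  refine intervalIntegral.integral_congr_ae ?_
  filter_upwards [hY', hH'] with s h1 h2 _
  exact (h1.inner ℝ h2).deriv.symm

namespace IsMinimalField

variable {n : ℕ} {Λ L : ℝ} {T : ℝ → Euc n}

/-- The integrated Euler-Lagrange equation away from a straight piece of direction `e`. -/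
theorem exists_momentum (h : IsMinimalField Λ L T) {α β a b : ℝ} {e : Euc n} (hα : 0 ≤ α)
    (hαβ : α < β) (hβ : β ≤ L) (he : ‖e‖ = 1) (hT : ∀ s ∈ Ioo α β, T s = e) (ha : 0 ≤ a)
    (hab : a < b) (hb : b ≤ L) (hdisj : Disjoint (Ioo α β) (Ioc a b)) :
    ∃ P₀ : Euc n, ∀ᵐ s, s ∈ Ioc a b → ((1 - ⟪e, T s⟫) / Λ ^ 2) • deriv T s
      + ∫ r in a..s, (e + (1 - 2 * ⟪e, T r⟫) • T r) = P₀ := by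
  have hΛ := h.pos
  have hL := h.length_pos
  have hTc := h.continuous
  have hDm := h.measurable_deriv
  set g : ℝ → Euc n := fun s => e + (1 - 2 * ⟪e, T s⟫) • T s with hg
  have hgc : Continuous g := by fun_prop
  have hx : ∀ s, ⟪e, T s⟫ ≤ 1 ∧ -1 ≤ ⟪e, T s⟫ := fun s => by
    have := abs_real_inner_le_norm e (T s)
    rw [he, h.unit, one_mul] at this
    exact ⟨(abs_le.1 this).2, (abs_le.1 this).1⟩
  have hg4 : ∀ s, ‖g s‖ ≤ (4 : NNReal) := fun s => by
    refine (norm_add_le _ _).trans ?_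
    rw [he, norm_smul, h.unit, mul_one, Real.norm_eq_abs]
    have : |1 - 2 * ⟪e, T s⟫| ≤ 3 := abs_le.2 ⟨by linarith [hx s], by linarith [hx s]⟩
    rw [NNReal.coe_ofNat]
    linarith
  set H : ℝ → Euc n := fun s => ∫ r in a..s, g r with hH
  have hHlip : LipschitzWith 4 H :=
    lipschitzWith_primitive hgc.measurable.aestronglyMeasurable hg4 a
  have hHc := hHlip.continuous
  have hHder := ae_hasDerivAt_primitive hgc.measurable.aestronglyMeasurable hg4 a
  obtain ⟨C, hC⟩ := (isCompact_Icc (a := a) (b := b)).exists_bound_of_continuousOn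
    hHc.continuousOn
  set P : ℝ → Euc n := fun s => ((1 - ⟪e, T s⟫) / Λ ^ 2) • deriv T s + H s with hP
  have hPm : Measurable P := by fun_prop
  have hPb : ∀ s ∈ Ioc a b, ‖P s‖ ≤ 2 / Λ ^ 2 * Λ + C := fun s hs => by
    refine (norm_add_le _ _).trans (add_le_add ?_ (hC s (Ioc_subset_Icc_self hs)))
    rw [norm_smul, norm_div, Real.norm_of_nonneg (sq_nonneg Λ),
      Real.norm_of_nonneg (by linarith [hx s])]
    have := h.norm_deriv_le s
    gcongr
    linarith [hx s]
  set A : Euc n := (b - a)⁻¹ • ∫ s in a..b, P s with hA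
  set E : ℝ → Euc n := (Ioc a b).indicator fun s => A - P s with hE
  have hEin : ∀ s ∈ Ioc a b, E s = A - P s := fun s hs => indicator_of_mem hs _
  have hEout : ∀ s ∉ Ioc a b, E s = 0 := fun s hs => indicator_of_notMem hs _
  have hEm : Measurable E := (measurable_const.sub hPm).indicator measurableSet_Ioc
  obtain ⟨M, hM⟩ : ∃ M : NNReal, ∀ s, ‖E s‖ ≤ M := by
    refine ⟨(‖A‖ + |2 / Λ ^ 2 * Λ + C|).toNNReal, fun s => ?_⟩
    rw [Real.coe_toNNReal _ (by positivity)]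
    by_cases hs : s ∈ Ioc a b
    · rw [hEin s hs]
      exact (norm_sub_le _ _).trans (by linarith [hPb s hs, le_abs_self (2 / Λ ^ 2 * Λ + C)])
    · rw [hEout s hs, norm_zero]; positivity
  have hEi := intervalIntegrable_of_norm_le hEm.aestronglyMeasurable hM
  have hE0 : ∫ s in 0..L, E s = 0 := by
    have hPi : IntegrableOn P (Ioc a b) :=
      Measure.integrableOn_of_bounded (by simp) hPm.aestronglyMeasurable
        ((ae_restrict_iff' measurableSet_Ioc).2 (ae_of_all _ hPb))
    rw [intervalIntegral.integral_of_le hL.le, hE, setIntegral_indicator measurableSet_Ioc,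
      inter_eq_self_of_subset_right (Ioc_subset_Ioc ha hb),
      integral_sub (integrable_const _) hPi, ← intervalIntegral.integral_of_le hab.le,
      ← intervalIntegral.integral_of_le hab.le, intervalIntegral.integral_const, hA, smul_smul,
      mul_inv_cancel₀ (sub_pos.2 hab).ne', one_smul, sub_self]
  set Y : ℝ → Euc n := fun s => ∫ r in 0..s, E r with hY
  have hYlip : LipschitzWith M Y := lipschitzWith_primitive hEm.aestronglyMeasurable hM 0
  have hYc := hYlip.continuous
  have hparts := hYlip.integral_inner_deriv_add hHlip (a := 0) (b := L)
    (ae_hasDerivAt_primitive hEm.aestronglyMeasurable hM 0) hHder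
  have hYL : ∫ r in 0..L, E r = 0 := hE0
  simp only [hY, hYL, intervalIntegral.integral_same, inner_zero_left, sub_zero] at hparts
  have i0 : IntervalIntegrable (fun s => ⟪A, E s⟫) volume 0 L :=
    intervalIntegrable_of_norm_le (M := ‖A‖ * M)
      (Measurable.aestronglyMeasurable (by fun_prop)) (fun s => (norm_inner_le_norm _ _).trans
      (mul_le_mul_of_nonneg_left (hM s) (norm_nonneg _))) _ _
  have i1 : IntervalIntegrable (fun s => ‖E s‖ ^ 2) volume 0 L :=
    intervalIntegrable_of_norm_le (M := (M : ℝ) ^ 2)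
      (Measurable.aestronglyMeasurable (by fun_prop)) (fun s => by
        rw [norm_pow, norm_norm]; exact pow_le_pow_left₀ (norm_nonneg _) (hM s) 2) _ _
  have i2 : IntervalIntegrable (fun s => ⟪Y s, g s⟫) volume 0 L :=
    Continuous.intervalIntegrable (by fun_prop) _ _
  have i3 : IntervalIntegrable (fun s => ⟪E s, H s⟫) volume 0 L := by
    rw [intervalIntegrable_iff_integrableOn_Ioc_of_le hL.le]
    obtain ⟨C', hC'⟩ := (isCompact_Icc (a := 0) (b := L)).exists_bound_of_continuousOn
      hHc.continuousOn
    refine Measure.integrableOn_of_bounded (M := M * C') (by simp)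
      (Measurable.aestronglyMeasurable (by fun_prop))
      ((ae_restrict_iff' measurableSet_Ioc).2 (ae_of_all _ fun s hs => ?_))
    exact (norm_inner_le_norm _ _).trans (mul_le_mul (hM s) (hC' s (Ioc_subset_Icc_self hs))
      (norm_nonneg _) M.2)
  have hpt : ∀ s, ⟪((1 - ⟪e, T s⟫) / Λ ^ 2) • deriv T s, E s⟫ - ⟪Y s, g s⟫
      = (⟪A, E s⟫ - ‖E s‖ ^ 2) - (⟪Y s, g s⟫ + ⟪E s, H s⟫) := fun s => by
    by_cases hs : s ∈ Ioc a b
    · have e1 : ((1 - ⟪e, T s⟫) / Λ ^ 2) • deriv T s = A - E s - H s := by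
        rw [hEin s hs, sub_sub_cancel, hP]; simp only [add_sub_cancel_right]
      rw [e1, inner_sub_left, inner_sub_left, real_inner_self_eq_norm_sq, real_inner_comm (H s)]
      ring
    · rw [hEout s hs]; simp
  have hAE : ∫ s in 0..L, ⟪A, E s⟫ = 0 := by
    have := (innerSL ℝ A).intervalIntegral_comp_comm (hEi 0 L)
    simpa only [innerSL_apply_apply, hE0, inner_zero_right] using this
  have hvar := (h.variation_nonneg hα hαβ hβ he hT ha hb hdisj hEm hM hEout hE0).trans_eq
    (intervalIntegral.integral_congr fun s _ => hpt s)
  rw [intervalIntegral.integral_sub (i0.sub i1) (i2.add i3), hparts,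
    intervalIntegral.integral_sub i0 i1, hAE] at hvar
  have hnn := intervalIntegral.integral_nonneg (μ := volume) hL.le fun s _ => sq_nonneg ‖E s‖
  have hz : ∫ s in 0..L, ‖E s‖ ^ 2 = 0 := by linarith
  rw [intervalIntegral.integral_eq_zero_iff_of_le_of_nonneg_ae hL.le
    (ae_of_all _ fun s => sq_nonneg _) i1] at hz
  refine ⟨A, ?_⟩
  filter_upwards [(ae_restrict_iff' measurableSet_Ioc).1 hz] with s hs hsab
  have h1 := hs (Ioc_subset_Ioc ha hb hsab)
  simp only [Pi.zero_apply, sq_eq_zero_iff, norm_eq_zero] at h1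
  rw [hEin s hsab, sub_eq_zero] at h1
  exact h1.symm

end IsMinimalField

theorem LipschitzWith.hasDerivAt_of_ae_deriv_eq {n : ℕ} {T V : ℝ → Euc n} {K : NNReal} {a b : ℝ}
    (hT : LipschitzWith K T) (hV : ContinuousOn V (Ioo a b))
    (h : ∀ᵐ s, s ∈ Ioo a b → deriv T s = V s) {s : ℝ} (hs : s ∈ Ioo a b) :
    HasDerivAt T (V s) s := by
  have hmem : Ioo a b ∈ 𝓝 s := Ioo_mem_nhds hs.1 hs.2
  have hprim : HasDerivAt (fun x => ∫ r in s..x, V r) (V s) s :=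
    intervalIntegral.integral_hasDerivAt_right (by simp)
      (hV.stronglyMeasurableAtFilter isOpen_Ioo s hs) (hV.continuousAt hmem)
  refine (hprim.const_add (T s)).congr_of_eventuallyEq ?_
  filter_upwards [hmem] with x hx
  rw [← sub_eq_iff_eq_add', ← hT.integral_deriv_eq_sub s x]
  refine intervalIntegral.integral_congr_ae ?_
  filter_upwards [h] with r hr hrx
  exact hr (ordConnected_Ioo.uIcc_subset hs hx (uIoc_subset_uIcc hrx))

theorem inner_eq_zero_of_hasDerivAt {n : ℕ} {T : ℝ → Euc n} {v : Euc n} {s : ℝ}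
    (hT : ∀ s, ‖T s‖ = 1) (h : HasDerivAt T v s) : ⟪T s, v⟫ = 0 := by
  have h1 : HasDerivAt (fun r => ⟪T r, T r⟫) (⟪T s, v⟫ + ⟪v, T s⟫) s := h.inner ℝ h
  have h2 : (fun r => ⟪T r, T r⟫) = fun _ => (1 : ℝ) := by
    ext r; rw [real_inner_self_eq_norm_sq, hT, one_pow]
  rw [h2] at h1
  have h3 := h1.unique (hasDerivAt_const s (1 : ℝ))
  rw [real_inner_comm (T s) v] at h3
  linarith

/-- The Euler-Lagrange equation has a first integral; it vanishes if `T` reaches `e`, and then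
the equation becomes that of circular motion. -/
theorem hasDerivAt_velocity {n : ℕ} {Λ a b : ℝ} {e : Euc n} {T V : ℝ → Euc n} (hΛ : 0 < Λ)
    (hab : a < b) (he : ‖e‖ = 1) (hT : ∀ s, ‖T s‖ = 1) (hTc : Continuous T)
    (hne : ∀ s ∈ Ioo a b, T s ≠ e) (hend : T a = e ∨ T b = e)
    (hV : ∀ s ∈ Ioo a b, ‖V s‖ = Λ) (hTV : ∀ s ∈ Ioo a b, HasDerivAt T (V s) s)
    (hVV : ∀ s ∈ Ioo a b, HasDerivAt V ((1 - ⟪e, T s⟫)⁻¹ •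
      (⟪e, V s⟫ • V s - Λ ^ 2 • (e + (1 - 2 * ⟪e, T s⟫) • T s))) s)
    {s : ℝ} (hs : s ∈ Ioo a b) : HasDerivAt V (-(Λ ^ 2) • T s) s := by
  have hx1 : ∀ s ∈ Ioo a b, 1 - ⟪e, T s⟫ ≠ 0 := fun s hs h0 =>
    hne s hs ((inner_eq_one_iff_of_norm_eq_one (𝕜 := ℝ) he (hT s)).1 (by linarith)).symm
  have horth : ∀ s ∈ Ioo a b, ⟪T s, V s⟫ = 0 := fun s hs =>
    inner_eq_zero_of_hasDerivAt hT (hTV s hs)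
  set G : ℝ → ℝ := fun s => 1 - ⟪e, T s⟫ ^ 2 - ⟪e, V s⟫ ^ 2 / Λ ^ 2 with hG
  set J : ℝ → ℝ := fun s => (1 - ⟪e, T s⟫) ^ 2 * G s with hJ
  have hJd : ∀ s ∈ Ioo a b, HasDerivAt J 0 s := fun s hs => by
    have dx : HasDerivAt (fun r => ⟪e, T r⟫) ⟪e, V s⟫ s := by
      simpa using (hasDerivAt_const s e).inner ℝ (hTV s hs)
    have dp : HasDerivAt (fun r => ⟪e, V r⟫) ((1 - ⟪e, T s⟫)⁻¹ *
        (⟪e, V s⟫ * ⟪e, V s⟫ - Λ ^ 2 * (1 + (1 - 2 * ⟪e, T s⟫) * ⟪e, T s⟫))) s := by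
      have := (hasDerivAt_const s e).inner ℝ (hVV s hs)
      refine this.congr_deriv ?_
      simp only [inner_smul_right, inner_sub_right, inner_add_right, real_inner_self_eq_norm_sq, he,
        inner_zero_left]
      ring
    have := ((dx.const_sub 1).pow 2).mul
      (((dx.pow 2).const_sub 1).sub ((dp.pow 2).div_const (Λ ^ 2)))
    refine this.congr_deriv ?_
    have := hx1 s hs
    simp only [Pi.pow_apply, Pi.sub_apply]
    field_simp
    ring
  have hJconst : ∀ s ∈ Ioo a b, ∀ t ∈ Ioo a b, J s = J t := fun s hs t ht =>
    isOpen_Ioo.is_const_of_deriv_eq_zero isPreconnected_Ioo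
      (fun r hr => (hJd r hr).differentiableAt.differentiableWithinAt)
      (fun r hr => (hJd r hr).deriv) hs ht
  have hGb : ∀ s ∈ Ioo a b, |G s| ≤ 1 := fun s hs => by
    have h1 := abs_real_inner_le_norm e (T s)
    have h2 := abs_real_inner_le_norm e (V s)
    rw [he, one_mul, hT] at h1
    rw [he, one_mul, hV s hs] at h2
    have h3 : ⟪e, T s⟫ ^ 2 ≤ 1 := by rwa [sq_le_one_iff_abs_le_one]
    have h4 : ⟪e, V s⟫ ^ 2 / Λ ^ 2 ≤ 1 := by
      rw [div_le_one (by positivity), ← sq_abs]; exact pow_le_pow_left₀ (abs_nonneg _) h2 2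
    have h5 : 0 ≤ ⟪e, V s⟫ ^ 2 / Λ ^ 2 := by positivity
    exact abs_le.2 ⟨by simp only [hG]; linarith, by simp only [hG]; nlinarith [sq_nonneg ⟪e, T s⟫]⟩
  have hJle : ∀ t ∈ Ioo a b, |J s| ≤ (1 - ⟪e, T t⟫) ^ 2 := fun t ht => by
    rw [hJconst s hs t ht, hJ, abs_mul, abs_of_nonneg (sq_nonneg _)]
    exact mul_le_of_le_one_right (sq_nonneg _) (hGb t ht)
  have hcont : Continuous fun t => (1 - ⟪e, T t⟫) ^ 2 := by fun_prop
  have hJ0 : |J s| ≤ 0 := by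
    rcases hend with h0 | h0
    · have hl : Tendsto (fun t => (1 - ⟪e, T t⟫) ^ 2) (𝓝[>] a) (𝓝 ((1 - ⟪e, T a⟫) ^ 2)) :=
        hcont.continuousAt.tendsto.mono_left nhdsWithin_le_nhds
      rw [h0, real_inner_self_eq_norm_sq, he, one_pow, sub_self, zero_pow two_ne_zero] at hl
      exact ge_of_tendsto hl (mem_of_superset (Ioo_mem_nhdsGT hab) hJle)
    · have hl : Tendsto (fun t => (1 - ⟪e, T t⟫) ^ 2) (𝓝[<] b) (𝓝 ((1 - ⟪e, T b⟫) ^ 2)) :=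
        hcont.continuousAt.tendsto.mono_left nhdsWithin_le_nhds
      rw [h0, real_inner_self_eq_norm_sq, he, one_pow, sub_self, zero_pow two_ne_zero] at hl
      exact ge_of_tendsto hl (mem_of_superset (Ioo_mem_nhdsLT hab) hJle)
  have hG0 : G s = 0 :=
    (mul_eq_zero.1 (abs_nonpos_iff.1 hJ0)).resolve_left (pow_ne_zero _ (hx1 s hs))
  have hdecomp : e - (⟪e, T s⟫ • T s + (⟪e, V s⟫ / Λ ^ 2) • V s) = 0 := by
    have h1 : ‖e - (⟪e, T s⟫ • T s + (⟪e, V s⟫ / Λ ^ 2) • V s)‖ ^ 2 = G s := by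
      rw [norm_sub_sq_real, norm_add_sq_real, inner_add_right, real_inner_smul_right,
        real_inner_smul_right, real_inner_smul_left, real_inner_smul_right, horth s hs, norm_smul,
        norm_smul, hT, hV s hs, he, mul_pow, mul_pow, Real.norm_eq_abs, Real.norm_eq_abs, sq_abs,
        sq_abs, hG]
      field_simp
      ring
    rw [hG0] at h1
    exact norm_eq_zero.1 (pow_eq_zero_iff two_ne_zero |>.1 h1)
  refine (hVV s hs).congr_deriv ?_
  have hx := hx1 s hs
  rw [inv_smul_eq_iff₀ hx]
  have e1 : e = ⟪e, T s⟫ • T s + (⟪e, V s⟫ / Λ ^ 2) • V s := sub_eq_zero.1 hdecomp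
  generalize ⟪e, T s⟫ = x at e1
  generalize ⟪e, V s⟫ = p at e1
  rw [e1, smul_add, smul_add, smul_smul _ (p / Λ ^ 2), mul_div_cancel₀ _ (by positivity)]
  module

/-- Circular motion, integrated. -/
theorem exists_eq_cos_add_sin {n : ℕ} {Λ a b : ℝ} {T V : ℝ → Euc n} (hΛ : 0 < Λ) (hab : a < b)
    (hT : ∀ s, ‖T s‖ = 1) (hTc : Continuous T) (hV : ∀ s ∈ Ioo a b, ‖V s‖ = Λ)
    (hTV : ∀ s ∈ Ioo a b, HasDerivAt T (V s) s)
    (hVV : ∀ s ∈ Ioo a b, HasDerivAt V (-(Λ ^ 2) • T s) s) :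
    ∃ A B : Euc n, ‖A‖ = 1 ∧ ‖B‖ = 1 ∧ ⟪A, B⟫ = 0 ∧
      ∀ s ∈ Icc a b, T s = Real.cos (Λ * s) • A + Real.sin (Λ * s) • B := by
  set A : ℝ → Euc n := fun s => Real.cos (Λ * s) • T s - (Λ⁻¹ * Real.sin (Λ * s)) • V s with hA
  set B : ℝ → Euc n := fun s => Real.sin (Λ * s) • T s + (Λ⁻¹ * Real.cos (Λ * s)) • V s with hB
  have hlin : ∀ s, HasDerivAt (fun r => Λ * r) Λ s := fun s => by
    simpa using (hasDerivAt_id s).const_mul Λ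
  have hcos : ∀ s, HasDerivAt (fun r => Real.cos (Λ * r)) (-Real.sin (Λ * s) * Λ) s := fun s =>
    (hlin s).cos
  have hsin : ∀ s, HasDerivAt (fun r => Real.sin (Λ * r)) (Real.cos (Λ * s) * Λ) s := fun s =>
    (hlin s).sin
  have hAd : ∀ s ∈ Ioo a b, HasDerivAt A 0 s := fun s hs => by
    refine (((hcos s).smul (hTV s hs)).sub
      (((hsin s).const_mul Λ⁻¹).smul (hVV s hs))).congr_deriv ?_
    match_scalars <;> field_simp <;> ring
  have hBd : ∀ s ∈ Ioo a b, HasDerivAt B 0 s := fun s hs => by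
    refine (((hsin s).smul (hTV s hs)).add
      (((hcos s).const_mul Λ⁻¹).smul (hVV s hs))).congr_deriv ?_
    match_scalars <;> field_simp <;> ring
  have hconst : ∀ {F : ℝ → Euc n}, (∀ s ∈ Ioo a b, HasDerivAt F 0 s) →
      ∀ s ∈ Ioo a b, ∀ t ∈ Ioo a b, F s = F t := fun hF s hs t ht =>
    isOpen_Ioo.is_const_of_deriv_eq_zero isPreconnected_Ioo
      (fun r hr => (hF r hr).differentiableAt.differentiableWithinAt)
      (fun r hr => (hF r hr).deriv) hs ht
  obtain ⟨t, ht⟩ := nonempty_Ioo.2 hab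
  have horth := inner_eq_zero_of_hasDerivAt hT (hTV t ht)
  have hcs := Real.sin_sq_add_cos_sq (Λ * t)
  have key : ∀ x y : ℝ, ‖x • T t + y • V t‖ ^ 2 = x ^ 2 + y ^ 2 * Λ ^ 2 := fun x y => by
    rw [norm_add_sq_real, real_inner_smul_left, real_inner_smul_right, horth, norm_smul, norm_smul,
      hT, hV t ht, mul_pow, mul_pow, Real.norm_eq_abs, Real.norm_eq_abs, sq_abs, sq_abs]
    ring
  refine ⟨A t, B t, ?_, ?_, ?_, ?_⟩
  · have h1 : ‖A t‖ ^ 2 = 1 := by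
      have := key (Real.cos (Λ * t)) (-(Λ⁻¹ * Real.sin (Λ * t)))
      rw [neg_smul, ← sub_eq_add_neg] at this
      rw [hA, this]; field_simp; linarith
    exact (pow_eq_one_iff_of_nonneg (norm_nonneg _) two_ne_zero).1 h1
  · have h1 : ‖B t‖ ^ 2 = 1 := by
      rw [hB, key]; field_simp; linarith
    exact (pow_eq_one_iff_of_nonneg (norm_nonneg _) two_ne_zero).1 h1
  · simp only [hA, hB, inner_sub_left, inner_add_right, real_inner_smul_left,
      real_inner_smul_right, real_inner_comm (T t) (V t), horth, real_inner_self_eq_norm_sq, hT,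
      hV t ht]
    field_simp
    ring
  · have hIoo : ∀ s ∈ Ioo a b, T s = Real.cos (Λ * s) • A t + Real.sin (Λ * s) • B t :=
      fun s hs => by
        rw [hconst hAd t ht s hs, hconst hBd t ht s hs, hA, hB]
        have h2 := Real.sin_sq_add_cos_sq (Λ * s)
        match_scalars
        · linear_combination -h2
        · ring
    have hcl : EqOn T (fun s => Real.cos (Λ * s) • A t + Real.sin (Λ * s) • B t)
        (closure (Ioo a b)) := EqOn.closure hIoo hTc (by fun_prop)
    rwa [closure_Ioo hab.ne] at hcl

namespace IsMinimalField

variable {n : ℕ} {Λ L : ℝ} {T : ℝ → Euc n}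

/-- Next to a straight piece, the direction of a minimizer moves along a great circle. -/
theorem exists_circle (h : IsMinimalField Λ L T) {α β a b : ℝ} {e : Euc n} (hα : 0 ≤ α)
    (hαβ : α < β) (hβ : β ≤ L) (he : ‖e‖ = 1) (hT : ∀ s ∈ Ioo α β, T s = e) (ha : 0 ≤ a)
    (hab : a < b) (hb : b ≤ L) (hne : ∀ s ∈ Ioo a b, T s ≠ e) (hend : T a = e ∨ T b = e) :
    ∃ A B : Euc n, ‖A‖ = 1 ∧ ‖B‖ = 1 ∧ ⟪A, B⟫ = 0 ∧
      ∀ s ∈ Icc a b, T s = Real.cos (Λ * s) • A + Real.sin (Λ * s) • B := by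
  have hΛ := h.pos
  have hTc := h.continuous
  have hdisj : Disjoint (Ioo α β) (Ioc a b) := disjoint_left.2 fun s hs hs' => by
    obtain ⟨t, ht⟩ := exists_between (max_lt hs'.1 hs.1)
    have h1 := max_lt_iff.1 ht.1
    exact hne t ⟨h1.1, ht.2.trans_le hs'.2⟩ (hT t ⟨h1.2, ht.2.trans hs.2⟩)
  obtain ⟨P₀, hP⟩ := h.exists_momentum hα hαβ hβ he hT ha hab hb hdisj
  set g : ℝ → Euc n := fun s => e + (1 - 2 * ⟪e, T s⟫) • T s with hg
  have hgc : Continuous g := by fun_prop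
  set H : ℝ → Euc n := fun s => ∫ r in a..s, g r with hH
  have hHd : ∀ s, HasDerivAt H (g s) s := fun s => hgc.integral_hasStrictDerivAt a s |>.hasDerivAt
  have hHc : Continuous H := continuous_iff_continuousAt.2 fun s => (hHd s).continuousAt
  have hx1 : ∀ s ∈ Ioo a b, 1 - ⟪e, T s⟫ ≠ 0 := fun s hs h0 =>
    hne s hs ((inner_eq_one_iff_of_norm_eq_one (𝕜 := ℝ) he (h.unit s)).1 (by linarith)).symm
  set V : ℝ → Euc n := fun s => (1 - ⟪e, T s⟫)⁻¹ • Λ ^ 2 • (P₀ - H s) with hV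
  have hVc : ContinuousOn V (Ioo a b) := by
    refine ContinuousOn.smul (ContinuousOn.inv₀ (by fun_prop) hx1) (by fun_prop)
  have hae : ∀ᵐ s, s ∈ Ioo a b → deriv T s = V s := by
    filter_upwards [hP] with s hs hsab
    have := hx1 s hsab
    rw [hV]
    simp only
    rw [← hs (Ioo_subset_Ioc_self hsab), eq_inv_smul_iff₀ this, add_sub_cancel_right, smul_smul,
      mul_div_cancel₀ _ (by positivity)]
  have hTV : ∀ s ∈ Ioo a b, HasDerivAt T (V s) s := fun s hs =>
    h.lipschitz.hasDerivAt_of_ae_deriv_eq hVc hae hs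
  have hVn : ∀ s ∈ Ioo a b, ‖V s‖ = Λ := by
    refine Measure.eqOn_open_of_ae_eq (μ := volume) (f := fun s => ‖V s‖) (g := fun _ => Λ) ?_
      isOpen_Ioo hVc.norm continuousOn_const
    refine (ae_restrict_iff' measurableSet_Ioo).2 ?_
    filter_upwards [hae, h.ae_norm_deriv_eq hα hαβ hβ he hT] with s h1 h2 hs
    rw [← h1 hs]
    exact h2 ⟨ha.trans_lt hs.1, hs.2.le.trans hb⟩ (hne s hs)
  have hVV : ∀ s ∈ Ioo a b, HasDerivAt V ((1 - ⟪e, T s⟫)⁻¹ •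
      (⟪e, V s⟫ • V s - Λ ^ 2 • (e + (1 - 2 * ⟪e, T s⟫) • T s))) s := fun s hs => by
    have dx : HasDerivAt (fun r => ⟪e, T r⟫) ⟪e, V s⟫ s := by
      simpa using (hasDerivAt_const s e).inner ℝ (hTV s hs)
    have hx := hx1 s hs
    refine (((dx.const_sub 1).inv hx).smul (((hHd s).const_sub P₀).const_smul (Λ ^ 2))).congr_deriv
      ?_
    generalize ⟪e, V s⟫ = y
    simp only [hV, hg, Pi.inv_apply, Pi.smul_apply]
    match_scalars <;> field_simp
  exact exists_eq_cos_add_sin hΛ hab h.unit hTc hVn hTV fun s hs =>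
    hasDerivAt_velocity hΛ hab he h.unit hTc hne hend hVn hTV hVV hs

/-- A circular piece of a minimizer does not contain a full turn. -/
theorem circle_length_lt (h : IsMinimalField Λ L T) {a b : ℝ} {A B : Euc n} (ha : 0 ≤ a)
    (hb : b ≤ L) (hT : ∀ s ∈ Icc a b, T s = Real.cos (Λ * s) • A + Real.sin (Λ * s) • B) :
    b - a < 2 * Real.pi / Λ := by
  have hΛ := h.pos
  by_contra! hlen
  have hlt : a < a + 2 * Real.pi / Λ := lt_add_of_pos_right _ (by positivity)
  have hle : a + 2 * Real.pi / Λ ≤ b := by linarith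
  have hper : Λ * (a + 2 * Real.pi / Λ) = Λ * a + 2 * Real.pi := by field_simp
  refine h.not_closed ha hlt (hle.trans hb) ?_ ?_
  · rw [hT a ⟨le_rfl, hlt.le.trans hle⟩, hT _ ⟨hlt.le, hle⟩, hper, Real.cos_add_two_pi,
      Real.sin_add_two_pi]
  · have e1 : ∫ s in a..a + 2 * Real.pi / Λ, T s = ∫ s in a..a + 2 * Real.pi / Λ,
        (Real.cos (Λ * s) • A + Real.sin (Λ * s) • B) :=
      intervalIntegral.integral_congr fun s hs => by
        rw [uIcc_of_le hlt.le] at hs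
        exact hT s ⟨hs.1, hs.2.trans hle⟩
    rw [e1]
    have hd : ∀ s, HasDerivAt (fun r => (Λ⁻¹ * Real.sin (Λ * r)) • A - (Λ⁻¹ * Real.cos (Λ * r)) • B)
        (Real.cos (Λ * s) • A + Real.sin (Λ * s) • B) s := fun s => by
      have hlin : HasDerivAt (fun r => Λ * r) Λ s := by
        simpa using (hasDerivAt_id s).const_mul Λ
      refine (((hlin.sin.const_mul Λ⁻¹).smul_const A).sub
        ((hlin.cos.const_mul Λ⁻¹).smul_const B)).congr_deriv ?_
      match_scalars <;> field_simp
    rw [intervalIntegral.integral_eq_sub_of_hasDerivAt (fun s _ => hd s)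
      (Continuous.intervalIntegrable (by fun_prop) _ _), hper, Real.cos_add_two_pi,
      Real.sin_add_two_pi, sub_self]

/-- The direction of a straight piece is attained on an interval. -/
theorem eq_on_Icc (h : IsMinimalField Λ L T) {α β a b : ℝ} {e : Euc n} (hα : 0 ≤ α)
    (hαβ : α < β) (hβ : β ≤ L) (he : ‖e‖ = 1) (hT : ∀ s ∈ Ioo α β, T s = e) (ha : 0 ≤ a)
    (hb : b ≤ L) (hTa : T a = e) (hTb : T b = e) : ∀ s ∈ Icc a b, T s = e := by
  intro s hs
  by_contra hse
  have hΛ := h.pos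
  have hcl : IsClosed {t | T t = e} := isClosed_eq h.continuous continuous_const
  obtain ⟨a', ⟨ha', hTa'⟩, hmax⟩ := (isCompact_Icc.inter_right hcl).exists_isGreatest
    (s := Icc a s ∩ {t | T t = e}) ⟨a, ⟨le_rfl, hs.1⟩, hTa⟩
  obtain ⟨b', ⟨hb', hTb'⟩, hmin⟩ := (isCompact_Icc.inter_right hcl).exists_isLeast
    (s := Icc s b ∩ {t | T t = e}) ⟨b, ⟨hs.2, le_rfl⟩, hTb⟩
  simp only [mem_ofPred_eq] at hTa' hTb'
  have has : a' < s := lt_of_le_of_ne ha'.2 fun h0 => hse (h0 ▸ hTa')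
  have hsb : s < b' := lt_of_le_of_ne hb'.1 fun h0 => hse (h0 ▸ hTb')
  have hne : ∀ t ∈ Ioo a' b', T t ≠ e := fun t ht hte => by
    rcases le_total t s with h1 | h1
    · exact ht.1.not_ge (hmax ⟨⟨ha'.1.trans ht.1.le, h1⟩, hte⟩)
    · exact ht.2.not_ge (hmin ⟨⟨h1, ht.2.le.trans hb'.2⟩, hte⟩)
  have ha0 := ha.trans ha'.1
  have hbL := hb'.2.trans hb
  have hab := has.trans hsb
  obtain ⟨A, B, hA, hB, hAB, hcirc⟩ :=
    h.exists_circle hα hαβ hβ he hT ha0 hab hbL hne (Or.inl hTa')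
  have hlen := h.circle_length_lt ha0 hbL hcirc
  rw [lt_div_iff₀ hΛ] at hlen
  have h1 : ⟪T b', T a'⟫ = Real.cos (Λ * (b' - a')) := by
    rw [hcirc a' (left_mem_Icc.2 hab.le), hcirc b' (right_mem_Icc.2 hab.le), mul_sub, Real.cos_sub]
    simp only [inner_add_left, inner_add_right, real_inner_smul_left, real_inner_smul_right,
      real_inner_self_eq_norm_sq, hA, hB, hAB, real_inner_comm A B]
    ring
  rw [hTa', hTb', real_inner_self_eq_norm_sq, he, one_pow] at h1
  have hpos : 0 < Λ * (b' - a') := mul_pos hΛ (sub_pos.2 hab)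
  exact hpos.ne' ((Real.cos_eq_one_iff_of_lt_of_lt (by linarith [Real.pi_pos])
    (by linarith)).1 h1.symm)

end IsMinimalField

theorem isArc_self {n : ℕ} (hn : 2 ≤ n) {Λ : ℝ} (hΛ : 0 < Λ) (f : ℝ → Euc n) (a : ℝ) :
    IsArc Λ f a a := by
  refine ⟨by rw [sub_self]; positivity, f a - Λ⁻¹ • EuclideanSpace.single ⟨0, by omega⟩ 1,
    EuclideanSpace.single ⟨0, by omega⟩ 1, EuclideanSpace.single ⟨1, by omega⟩ 1, a, by simp,
    by simp, ?_, fun s hs => ?_⟩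
  · rw [EuclideanSpace.inner_single_left]; simp
  · obtain rfl : s = a := le_antisymm hs.2 hs.1
    simp

/-- A curve whose direction moves along a great circle at speed `Λ` is an arc. -/
theorem isArc_of_circle {n : ℕ} {Λ a b : ℝ} {f : ℝ → Euc n} {A B : Euc n} (hΛ : 0 < Λ)
    (hab : b - a < 2 * Real.pi / Λ) (hA : ‖A‖ = 1) (hB : ‖B‖ = 1) (hAB : ⟪A, B⟫ = 0)
    (hf : ∀ s ∈ Icc a b,
      HasDerivWithinAt f (Real.cos (Λ * s) • A + Real.sin (Λ * s) • B) (Icc a b) s) :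
    IsArc Λ f a b := by
  set F : ℝ → Euc n := fun s => f s -
    ((Λ⁻¹ * Real.cos (Λ * (s - 0))) • (-B) + (Λ⁻¹ * Real.sin (Λ * (s - 0))) • A) with hF
  have hFd : ∀ s ∈ Icc a b, HasDerivWithinAt F 0 (Icc a b) s := fun s hs => by
    have hlin : HasDerivAt (fun r => Λ * (r - 0)) Λ s := by
      simpa using ((hasDerivAt_id s).sub_const 0).const_mul Λ
    refine ((hf s hs).sub (((hlin.cos.const_mul Λ⁻¹).smul_const (-B)).add
      ((hlin.sin.const_mul Λ⁻¹).smul_const A)).hasDerivWithinAt).congr_deriv ?_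
    rw [sub_zero]
    match_scalars <;> field_simp <;> ring
  have hconst : ∀ s ∈ Icc a b, F s = F a :=
    constant_of_has_deriv_right_zero (fun s hs => (hFd s hs).continuousWithinAt) fun s hs =>
      (hFd s (Ico_subset_Icc_self hs)).mono_of_mem_nhdsWithin (Icc_mem_nhdsGE_of_mem hs)
  refine ⟨hab, F a, -B, A, 0, by rwa [norm_neg], hA, ?_, fun s hs => ?_⟩
  · rw [inner_neg_left, real_inner_comm, hAB, neg_zero]
  · rw [add_assoc, ← sub_eq_iff_eq_add]
    exact hconst s hs

/-- The chord between two unit vectors is at most the angle. -/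
theorem norm_sub_le_angle {n : ℕ} {x y : Euc n} (hx : ‖x‖ = 1) (hy : ‖y‖ = 1) :
    ‖x - y‖ ≤ InnerProductGeometry.angle x y := by
  refine (sq_le_sq₀ (norm_nonneg _) (InnerProductGeometry.angle_nonneg x y)).1 ?_
  have h1 := Real.one_sub_sq_div_two_le_cos (x := InnerProductGeometry.angle x y)
  have h2 := InnerProductGeometry.cos_angle x y
  rw [hx, hy, mul_one, div_one] at h2
  rw [norm_sub_sq_real, hx, hy]
  linarith

namespace CurveCC

variable {n : ℕ} {p q v w : Euc n} {Λ : ℝ}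

/-- The direction field of a curve, extended to the line by constants. -/
noncomputable def tangent (γ : CurveCC n p q v w Λ) (s : ℝ) : Euc n := γ.fd (projIcc 0 γ.L γ.Lnn s)

theorem tangent_eq (γ : CurveCC n p q v w Λ) {s : ℝ} (hs : s ∈ Icc 0 γ.L) :
    γ.tangent s = γ.fd s := by
  rw [tangent, projIcc_of_mem _ hs]

theorem norm_tangent (γ : CurveCC n p q v w Λ) (s : ℝ) : ‖γ.tangent s‖ = 1 :=
  γ.unit _ (projIcc 0 γ.L γ.Lnn s).2

theorem lipschitzWith_tangent (γ : CurveCC n p q v w Λ) :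
    LipschitzWith Λ.toNNReal γ.tangent := by
  have := γ.lip.to_restrict.comp (LipschitzWith.projIcc γ.Lnn)
  rwa [mul_one] at this

theorem integral_tangent (γ : CurveCC n p q v w Λ) : ∫ s in 0..γ.L, γ.tangent s = q - p := by
  trans γ.f γ.L - γ.f 0
  swap
  · rw [γ.iL, γ.i0]
  refine intervalIntegral.integral_eq_sub_of_hasDerivAt_of_le γ.Lnn
    (fun s hs => (γ.deriv s hs).continuousWithinAt) (fun s hs => ?_)
    (γ.lipschitzWith_tangent.continuous.intervalIntegrable _ _)
  rw [γ.tangent_eq (Ioo_subset_Icc_self hs)]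
  exact (γ.deriv s (Ioo_subset_Icc_self hs)).hasDerivAt (Icc_mem_nhds hs.1 hs.2)

theorem isMinimalField (γ : CurveCC n p q v w Λ) (hΛ : 0 < Λ) (hL : 0 < γ.L)
    (hmin : ∀ η : CurveCC n p q v w Λ, γ.L ≤ η.L) : IsMinimalField Λ γ.L γ.tangent := by
  refine ⟨hΛ, hL, γ.norm_tangent, γ.lipschitzWith_tangent, fun m U hadm hI => ?_⟩
  rw [γ.tangent_eq (left_mem_Icc.2 hL.le), γ.tangent_eq (right_mem_Icc.2 hL.le), γ.id0, γ.idL]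
    at hadm
  obtain ⟨η, hη⟩ := hadm.exists_curve hΛ.le hL.le (p := p) (q := q) (by
    rw [hI, γ.integral_tangent, add_sub_cancel])
  exact (hmin η).trans_eq hη

/-- Slack curvature at a parameter gives slack curvature on an interval. -/
theorem exists_norm_deriv_tangent_le (γ : CurveCC n p q v w Λ) (hL : 0 < γ.L) (hΛ : 0 < Λ)
    {s₀ : ℝ} (hs₀ : s₀ ∈ Icc 0 γ.L) (hlt : CurvLt γ.fd (Icc 0 γ.L) s₀ Λ) :
    ∃ α β κ, 0 ≤ α ∧ α < β ∧ β ≤ γ.L ∧ κ < Λ ∧ ∀ s ∈ Ioo α β, ‖_root_.deriv γ.tangent s‖ ≤ κ := by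
  obtain ⟨δ, hδ, κ, hκ, hang⟩ := hlt
  refine ⟨max 0 (s₀ - δ), min γ.L (s₀ + δ), max κ 0, le_max_left _ _, ?_, min_le_left _ _,
    max_lt hκ hΛ, fun s hs => ?_⟩
  · refine max_lt (lt_min hL ?_) (lt_min ?_ ?_) <;> linarith [hs₀.1, hs₀.2]
  refine (norm_deriv_le_of_lipschitzOn (C := (max κ 0).toNNReal) (Ioo_mem_nhds hs.1 hs.2)
    ?_).trans_eq
    (Real.coe_toNNReal _ (le_max_right _ _))
  refine LipschitzOnWith.of_dist_le_mul fun x hx y hy => ?_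
  rw [Real.coe_toNNReal _ (le_max_right _ _), dist_eq_norm, Real.dist_eq]
  have hmem : ∀ r ∈ Ioo (max 0 (s₀ - δ)) (min γ.L (s₀ + δ)), r ∈ Icc 0 γ.L ∧ |r - s₀| < δ :=
    fun r hr => by
      have h1 := max_lt_iff.1 hr.1
      have h2 := lt_min_iff.1 hr.2
      exact ⟨⟨h1.1.le, h2.1.le⟩, abs_lt.2 ⟨by linarith, by linarith⟩⟩
  obtain ⟨hx0, hxδ⟩ := hmem x hx
  obtain ⟨hy0, hyδ⟩ := hmem y hy
  rcases eq_or_ne x y with rfl | hxy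
  · simp
  rw [γ.tangent_eq hx0, γ.tangent_eq hy0]
  exact (norm_sub_le_angle (γ.unit x hx0) (γ.unit y hy0)).trans
    ((hang x hx0 y hy0 hxy hxδ hyδ).trans
      (mul_le_mul_of_nonneg_right (le_max_left _ _) (abs_nonneg _)))

/-- The curve is an arc between a straight piece and an end of the curve. -/
theorem isArc_of_ne (γ : CurveCC n p q v w Λ) (hn : 2 ≤ n)
    (h : IsMinimalField Λ γ.L γ.tangent) {α β a b : ℝ}
    {e : Euc n} (hα : 0 ≤ α) (hαβ : α < β) (hβ : β ≤ γ.L) (he : ‖e‖ = 1)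
    (hT : ∀ s ∈ Ioo α β, γ.tangent s = e) (ha : 0 ≤ a) (hab : a ≤ b) (hb : b ≤ γ.L)
    (hne : ∀ s ∈ Ioo a b, γ.tangent s ≠ e) (hend : γ.tangent a = e ∨ γ.tangent b = e) :
    IsArc Λ γ.f a b := by
  rcases hab.eq_or_lt with rfl | hab
  · exact isArc_self hn h.pos _ _
  obtain ⟨A, B, hA, hB, hAB, hcirc⟩ := h.exists_circle hα hαβ hβ he hT ha hab hb hne hend
  refine isArc_of_circle h.pos (h.circle_length_lt ha hb hcirc) hA hB hAB fun s hs => ?_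
  have hsub := Icc_subset_Icc ha hb
  rw [← hcirc s hs, γ.tangent_eq (hsub hs)]
  exact (γ.deriv s (hsub hs)).mono hsub

end CurveCC

/-- A length-minimizer in `C(p,q;v,w;Λ)` with ball radius `≥ 1/Λ` and
curvature `< Λ` somewhere is a `CLC(Λ)` curve on all of `[0, L]`. -/
theorem statement_1 {n : ℕ} (hn : 2 ≤ n) (p q v w : Euc n)
    (hv : ‖v‖ = 1) (hw : ‖w‖ = 1) (Λ : ℝ) (hΛ : 0 < Λ)
    (γ : CurveCC n p q v w Λ)
    (hmin : ∀ η : CurveCC n p q v w Λ, γ.L ≤ η.L)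
    (hRO : 1 / Λ ≤ RO γ.f γ.fd (Set.Icc 0 γ.L))
    (s₀ : ℝ) (hs₀ : s₀ ∈ Set.Icc (0 : ℝ) γ.L)
    (hlt : CurvLt γ.fd (Set.Icc 0 γ.L) s₀ Λ) :
    ∃ c d : ℝ, 0 ≤ c ∧ c ≤ d ∧ d ≤ γ.L ∧
      (∀ s ∈ Set.Icc c d, γ.fd s = γ.fd c) ∧
      IsArc Λ γ.f 0 c ∧ IsArc Λ γ.f d γ.L := by
  rcases γ.Lnn.eq_or_lt with hL | hL
  · refine ⟨0, 0, le_rfl, le_rfl, γ.Lnn, fun s hs => ?_, isArc_self hn hΛ _ _, ?_⟩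
    · rw [le_antisymm hs.2 hs.1]
    · rw [← hL]; exact isArc_self hn hΛ _ _
  have h := γ.isMinimalField hΛ hL hmin
  obtain ⟨α, β, κ, hα, hαβ, hβ, hκ, hd⟩ := γ.exists_norm_deriv_tangent_le hL hΛ hs₀ hlt
  obtain ⟨e, hT⟩ := h.exists_eq_const hα hαβ hβ hκ hd
  obtain ⟨t, ht⟩ := nonempty_Ioo.2 hαβ
  have he : ‖e‖ = 1 := hT t ht ▸ γ.norm_tangent t
  have hcpt : IsCompact (Icc 0 γ.L ∩ {s | γ.tangent s = e}) :=
    isCompact_Icc.inter_right (isClosed_eq h.continuous continuous_const)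
  have hnemp : (Icc 0 γ.L ∩ {s | γ.tangent s = e}).Nonempty :=
    ⟨t, ⟨hα.trans ht.1.le, ht.2.le.trans hβ⟩, hT t ht⟩
  obtain ⟨c, ⟨hc, hTc : γ.tangent c = e⟩, hcmin⟩ := hcpt.exists_isLeast hnemp
  obtain ⟨d, ⟨hd, hTd : γ.tangent d = e⟩, hdmax⟩ := hcpt.exists_isGreatest hnemp
  have hcd : c ≤ d := hdmax ⟨hc, hTc⟩
  refine ⟨c, d, hc.1, hcd, hd.2, fun s hs => ?_, ?_, ?_⟩
  · rw [← γ.tangent_eq hc, ← γ.tangent_eq ⟨hc.1.trans hs.1, hs.2.trans hd.2⟩, hTc]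
    exact h.eq_on_Icc hα hαβ hβ he hT hc.1 hd.2 hTc hTd s hs
  · exact γ.isArc_of_ne hn h hα hαβ hβ he hT le_rfl hc.1 hc.2
      (fun s hs hse => hs.2.not_ge (hcmin ⟨⟨hs.1.le, hs.2.le.trans hc.2⟩, hse⟩)) (Or.inr hTc)
  · exact γ.isArc_of_ne hn h hα hαβ hβ he hT hd.1 hd.2 le_rfl
      (fun s hs hse => hs.1.not_ge (hdmax ⟨⟨hd.1.trans hs.1.le, hs.2.le⟩, hse⟩)) (Or.inl hTd)
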